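/- Let G be the pseudograph with three nodes 1, 2, 3, a bundle {a, b} between nodes 1 and 2, and a simple edge between nodes 2 and 3. Then the Poincaré polynomial of the associated real toric manifold M_G is Poin_{M_G}(t) = 1 + 3t + 2t². -/

import Mathlib

attribute [local instance] Classical.propDecidable

/-- An abstract simplicial complex on a vertex type `α` (faces are downward closed). -/
structure ASC (α : Type) where
  faces : Set (Finset α)
  down_closed : ∀ {s t : Finset α}, s ∈ faces → t ⊆ s → t ∈ faces

namespace ASC

variable {α β : Type}

/-- The geometric realization of an abstract simplicial complex, as the space of
convex-combination weight functions supported on a face. -/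
def realization [Fintype α] (K : ASC α) : Type :=
  {f : α → ℝ // (∀ a, 0 ≤ f a) ∧ (∑ a, f a) = 1 ∧
    (Finset.univ.filter fun a => f a ≠ 0) ∈ K.faces}

instance [Fintype α] (K : ASC α) : TopologicalSpace K.realization :=
  inferInstanceAs (TopologicalSpace {f : α → ℝ // _})

/-- `a` is a vertex of `K`. -/
def IsVertex (K : ASC α) (a : α) : Prop := {a} ∈ K.faces

/-- The complex `K \ St a`: all faces of `K` not containing `a`. -/
def delStar (K : ASC α) (a : α) : ASC α where
  faces := {s | s ∈ K.faces ∧ a ∉ s}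
  down_closed := fun hs hts => ⟨K.down_closed hs.1 hts, fun hat => hs.2 (hts hat)⟩

/-- The link of a vertex `a` in `K`. -/
def link (K : ASC α) (a : α) : ASC α where
  faces := {s | s ∈ K.faces ∧ a ∉ s ∧ insert a s ∈ K.faces}
  down_closed := fun hs hts =>
    ⟨K.down_closed hs.1 hts, fun hat => hs.2.1 (hts hat),
      K.down_closed hs.2.2 (Finset.insert_subset_insert _ hts)⟩

/-- The join of two abstract simplicial complexes. -/
def join (K : ASC α) (L : ASC β) : ASC (α ⊕ β) where
  faces := {s | ∃ u ∈ K.faces, ∃ v ∈ L.faces, s = u.image Sum.inl ∪ v.image Sum.inr}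
  down_closed := by
    rintro s t ⟨u, hu, v, hv, rfl⟩ hts
    refine ⟨u.filter (fun x => Sum.inl x ∈ t), K.down_closed hu (Finset.filter_subset _ _),
      v.filter (fun y => Sum.inr y ∈ t), L.down_closed hv (Finset.filter_subset _ _), ?_⟩
    ext x
    constructor
    · intro hx
      have hx' := hts hx
      simp only [Finset.mem_union, Finset.mem_image, Finset.mem_filter] at hx' ⊢
      rcases hx' with ⟨y, hy, rfl⟩ | ⟨y, hy, rfl⟩
      · exact Or.inl ⟨y, ⟨hy, hx⟩, rfl⟩
      · exact Or.inr ⟨y, ⟨hy, hx⟩, rfl⟩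
    · intro hx
      simp only [Finset.mem_union, Finset.mem_image, Finset.mem_filter] at hx
      rcases hx with ⟨y, ⟨hy, hyt⟩, rfl⟩ | ⟨y, ⟨hy, hyt⟩, rfl⟩ <;> exact hyt

/-- The join of a finite family of simplicial complexes on a common vertex type
(with pairwise disjoint vertex sets in applications). -/
def famJoin {ι : Type} [Fintype ι] (K : ι → ASC α) : ASC α where
  faces := {s | ∃ f : ι → Finset α, (∀ i, f i ∈ (K i).faces) ∧ s = Finset.univ.biUnion f}
  down_closed := by
    intro s t hs hts
    obtain ⟨f, hf, rfl⟩ := hs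
    refine ⟨fun i => f i ∩ t, fun i => (K i).down_closed (hf i) Finset.inter_subset_left, ?_⟩
    ext a
    simp only [Finset.mem_biUnion, Finset.mem_inter, Finset.mem_univ, true_and]
    constructor
    · intro ha
      obtain ⟨i, hi⟩ := Finset.mem_biUnion.1 (hts ha)
      exact ⟨i, hi.2, ha⟩
    · rintro ⟨i, hi, ha⟩
      exact ha

end ASC
open CategoryTheory in
/-- The singular chain complex of a topological space with rational coefficients. -/
noncomputable def singularChains (X : Type) [TopologicalSpace X] : ChainComplex (ModuleCat ℚ) ℕ :=
  (AlgebraicTopology.alternatingFaceMapComplex (ModuleCat ℚ)).obj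
    (((CategoryTheory.SimplicialObject.whiskering _ _).obj (ModuleCat.free ℚ)).obj
      (TopCat.toSSet.obj (TopCat.of X)))

/-- The `n`-th rational Betti number of a topological space, via singular homology. -/
noncomputable def betti (X : Type) [TopologicalSpace X] (n : ℕ) : ℕ :=
  Module.finrank ℚ ((singularChains X).homology n)

open Classical in
/-- The reduced rational Betti numbers, indexed by `ℤ`
(`rbetti X (-1) = 1` for the empty space). -/
noncomputable def rbetti (X : Type) [TopologicalSpace X] (n : ℤ) : ℕ :=
  if n = -1 then (if IsEmpty X then 1 else 0)
  else if 0 ≤ n then betti X n.toNat - (if n = 0 ∧ Nonempty X then 1 else 0)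
  else 0

/-! ## Pseudographs, tubes and tubing complexes -/

/-- An ambient multigraph structure without loops: each edge label in `E` is assigned an
unordered pair of distinct nodes of `V`. -/
structure Amb (V E : Type) where
  ends : E → Sym2 V
  noLoop : ∀ e, ¬ (ends e).IsDiag

variable {V E : Type} [Fintype V] [Fintype E] [DecidableEq V] [DecidableEq E]

/-- A pseudograph (without loops) on nodes from `V` with edges from `E`: a subgraph of the
ambient structure `A`, given by a finite set of nodes and a finite set of edges whose
endpoints belong to the node set. -/
structure PSG (A : Amb V E) where
  verts : Finset V
  edges : Finset E
  incl : ∀ e ∈ edges, ∀ v ∈ A.ends e, v ∈ verts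

namespace PSG

variable {A : Amb V E}

noncomputable instance : DecidableEq (PSG A) := Classical.decEq _

noncomputable instance : Fintype (PSG A) :=
  Fintype.ofInjective (fun H => (H.verts, H.edges))
    (by intro a b h; cases a; cases b; simp_all)

/-- The parallel class (possibly a bundle) of edges of `H` with endpoint pair `s`. -/
def cls (H : PSG A) (s : Sym2 V) : Finset E :=
  H.edges.filter fun e => A.ends e = s

/-- `e` is a multiple edge of `H`. -/
def MultipleIn (H : PSG A) (e : E) : Prop :=
  e ∈ H.edges ∧ 2 ≤ (H.cls (A.ends e)).card

/-- `I` is a subgraph of `H`. -/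
def Le (I H : PSG A) : Prop := I.verts ⊆ H.verts ∧ I.edges ⊆ H.edges

/-- Adjacency of two nodes via an edge of `H`. -/
def adjIn (H : PSG A) (v w : V) : Prop := ∃ e ∈ H.edges, A.ends e = s(v, w)

/-- Reachability inside `H`. -/
def reachIn (H : PSG A) : V → V → Prop := Relation.ReflTransGen (adjIn H)

/-- `H` is a (nonempty) connected pseudograph. -/
def ConnIn (H : PSG A) : Prop :=
  H.verts.Nonempty ∧ ∀ v ∈ H.verts, ∀ w ∈ H.verts, reachIn H v w

/-- `I` is a semi-induced subgraph of `H`: it contains at least one edge between every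
pair of its nodes joined by an edge of `H`. -/
def SemiInducedIn (H I : PSG A) : Prop :=
  Le I H ∧ ∀ e ∈ H.edges, (∀ v ∈ A.ends e, v ∈ I.verts) →
    ∃ e' ∈ I.edges, A.ends e' = A.ends e

/-- `J` is a connected component of `H`. -/
def IsComponent (H J : PSG A) : Prop :=
  Le J H ∧ J.verts.Nonempty ∧ ConnIn J ∧
    (J.edges = H.edges.filter fun e => ∀ v ∈ A.ends e, v ∈ J.verts) ∧
    ∀ e ∈ H.edges, (∃ v ∈ A.ends e, v ∈ J.verts) → ∀ v ∈ A.ends e, v ∈ J.verts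

/-- `I` is properly contained in its connected component of `H`. -/
def ProperIn (H I : PSG A) : Prop :=
  (∃ v ∈ H.verts, v ∉ I.verts ∧ ∃ w ∈ I.verts, reachIn H v w) ∨
    (∃ e ∈ H.edges, (∀ v ∈ A.ends e, v ∈ I.verts) ∧ e ∉ I.edges)

/-- `I` is a tube of `H`: a proper connected semi-induced subgraph of a connected
component of `H`. -/
def TubeIn (H I : PSG A) : Prop := SemiInducedIn H I ∧ ConnIn I ∧ ProperIn H I

/-- Two subgraphs meet by separation in `H`: they are disjoint and no edge of `H`
connects them. -/
def SeparatedIn (H I J : PSG A) : Prop :=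
  Disjoint I.verts J.verts ∧
    ∀ e ∈ H.edges, ¬ ((∃ v ∈ A.ends e, v ∈ I.verts) ∧ ∃ v ∈ A.ends e, v ∈ J.verts)

/-- Two tubes are compatible: they coincide, meet by inclusion, or meet by separation. -/
def Compatible (H I J : PSG A) : Prop :=
  I = J ∨ Le I J ∨ Le J I ∨ SeparatedIn H I J

/-- The simplicial complex of all tubings of `H` (dual to the boundary of the pseudograph
associahedron `P_H`). -/
def tubingComplex (H : PSG A) : ASC (PSG A) where
  faces := {S | (∀ I ∈ S, TubeIn H I) ∧ ∀ I ∈ S, ∀ J ∈ S, Compatible H I J}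
  down_closed := fun hs hts =>
    ⟨fun I hI => hs.1 I (hts hI), fun I hI J hJ => hs.2 I (hts hI) J (hts hJ)⟩

end PSG

/-- A collection of nodes and (multiple) edges, i.e. a candidate subset of `C_G`. -/
abbrev Coll (V E : Type) := Finset V × Finset E

namespace PSG

variable {A : Amb V E}

/-- The number of elements of the collection `C` belonging to the subgraph `I`,
i.e. `|I ∩ C|`. -/
def interCard (I : PSG A) (C : Coll V E) : ℕ :=
  (I.verts ∩ C.1).card + (I.edges ∩ C.2).card

/-- `C ∈ 2^{C_G}_even`: `C` consists of nodes and multiple edges of `G`, with evenly many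
nodes and evenly many edges from each bundle. -/
def EvenColl (G : PSG A) (C : Coll V E) : Prop :=
  C.1 ⊆ G.verts ∧ C.2 ⊆ G.edges ∧ (∀ e ∈ C.2, MultipleIn G e) ∧
    Even C.1.card ∧ ∀ s : Sym2 V, Even ((C.2 ∩ G.cls s).card)

/-- The subgraph `Γ̃_G(C)` of `G` induced by the nodes belonging to `C` or incident to an
edge of `C`. -/
def GammaTilde (G : PSG A) (C : Coll V E) : PSG A where
  verts := G.verts.filter fun v => v ∈ C.1 ∨ ∃ e ∈ C.2, v ∈ A.ends e
  edges := G.edges.filter fun e => ∀ v ∈ A.ends e,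
    v ∈ G.verts.filter fun v => v ∈ C.1 ∨ ∃ e ∈ C.2, v ∈ A.ends e
  incl := by
    intro e he v hv
    exact (Finset.mem_filter.1 he).2 v hv

/-- The simplicial complex `K^odd_{C,G}`: tubings of `G` consisting of tubes `I` with
`|I ∩ C|` odd. -/
def Kodd (G : PSG A) (C : Coll V E) : ASC (PSG A) where
  faces := {S | S ∈ (tubingComplex G).faces ∧ ∀ I ∈ S, Odd (interCard I C)}
  down_closed := fun hs hts =>
    ⟨(tubingComplex G).down_closed hs.1 hts, fun I hI => hs.2 I (hts hI)⟩

/-- The subcomplex `K'_{C,G}` of `K^odd_{C,G}` on the tubes contained in `Γ̃_G(C)`. -/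
def Kp (G : PSG A) (C : Coll V E) : ASC (PSG A) where
  faces := {S | S ∈ (Kodd G C).faces ∧ ∀ I ∈ S, Le I (GammaTilde G C)}
  down_closed := fun hs hts =>
    ⟨(Kodd _ _).down_closed hs.1 hts, fun I hI => hs.2 I (hts hI)⟩

/-- The bundle condition on a tube `I`: for every bundle `B` of `Γ̃_G(C)` disjoint from
`C`, if both endpoints of `B` lie in `I` then `B ⊆ I`. -/
def BundleOK (G : PSG A) (C : Coll V E) (I : PSG A) : Prop :=
  ∀ s : Sym2 V, 2 ≤ ((GammaTilde G C).cls s).card →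
    C.2 ∩ (GammaTilde G C).cls s = ∅ →
    (∀ v ∈ s, v ∈ I.verts) → (GammaTilde G C).cls s ⊆ I.edges

/-- The subcomplex `K''_{C,G}` of `K'_{C,G}` on the tubes satisfying the bundle
condition. -/
def Kpp (G : PSG A) (C : Coll V E) : ASC (PSG A) where
  faces := {S | S ∈ (Kp G C).faces ∧ ∀ I ∈ S, BundleOK G C I}
  down_closed := fun hs hts =>
    ⟨(Kp _ _).down_closed hs.1 hts, fun I hI => hs.2 I (hts hI)⟩

/-- The restriction `C ∩ J` of a collection to a subgraph `J`. -/
def restrictColl (C : Coll V E) (J : PSG A) : Coll V E := (C.1 ∩ J.verts, C.2 ∩ J.edges)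

/-- `C ∈ 2^{C_G}_even*`: moreover every connected component of `Γ̃_G(C)` is even with
respect to `C`. -/
def EvenStar (G : PSG A) (C : Coll V E) : Prop :=
  EvenColl G C ∧ ∀ J : PSG A, IsComponent (GammaTilde G C) J → Even (interCard J C)

/-- The subgraph of `G` induced by a set `W` of nodes. -/
def inducedSub (G : PSG A) (W : Finset V) : PSG A where
  verts := W ∩ G.verts
  edges := G.edges.filter fun e => ∀ v ∈ A.ends e, v ∈ W ∩ G.verts
  incl := by
    intro e he v hv
    exact (Finset.mem_filter.1 he).2 v hv

/-- `H` is a partial underlying pseudograph of `H'`: it has the same nodes, and each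
parallel class of `H'` is either kept entirely or replaced by a single (simple) edge. -/
def PartialUnderlying (H' H : PSG A) : Prop :=
  H.verts = H'.verts ∧ H.edges ⊆ H'.edges ∧
    ∀ s : Sym2 V, H'.cls s ⊆ H.edges ∨ (H.edges ∩ H'.cls s).card = 1

/-- `H ⋖ G`: `H` is a partial underlying pseudograph of an induced subgraph of `G`. -/
def Lt (H G : PSG A) : Prop := ∃ W : Finset V, PartialUnderlying (inducedSub G W) H

/-- `H` is (a representative of) the pseudograph `Γ_G(C)`, obtained from `Γ̃_G(C)` by
replacing each bundle disjoint from `C` by a single simple edge. -/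
def IsGammaOf (G : PSG A) (C : Coll V E) (H : PSG A) : Prop :=
  H.verts = (GammaTilde G C).verts ∧ H.edges ⊆ (GammaTilde G C).edges ∧
    ∀ s : Sym2 V,
      (((C.2 ∩ (GammaTilde G C).cls s).Nonempty ∨ ((GammaTilde G C).cls s).card ≤ 1) →
        (GammaTilde G C).cls s ⊆ H.edges) ∧
      (C.2 ∩ (GammaTilde G C).cls s = ∅ → 2 ≤ ((GammaTilde G C).cls s).card →
        (H.edges ∩ (GammaTilde G C).cls s).card = 1)

/-- Admissibility of a collection `C` for a connected pseudograph `J`: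
(a1) evenness, (a2) `C` contains every node not incident to a bundle, and
(a3) `C` meets every bundle. -/
def AdmissibleConn (J : PSG A) (C : Coll V E) : Prop :=
  Even ((C.1 ∩ J.verts).card) ∧ (∀ s : Sym2 V, Even ((C.2 ∩ J.cls s).card)) ∧
    (∀ v ∈ J.verts, (∀ s : Sym2 V, v ∈ s → (J.cls s).card ≤ 1) → v ∈ C.1) ∧
    ∀ s : Sym2 V, 2 ≤ (J.cls s).card → (C.2 ∩ J.cls s).Nonempty

/-- `C` is an admissible collection of the pseudograph `H` (componentwise). -/
def Admissible (H : PSG A) (C : Coll V E) : Prop :=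
  C.1 ⊆ H.verts ∧ C.2 ⊆ H.edges ∧ (∀ e ∈ C.2, MultipleIn H e) ∧
    ∀ J : PSG A, IsComponent H J → AdmissibleConn J C

end PSG

/-! ## Real toric spaces from characteristic functions -/

instance : TopologicalSpace (ZMod 2) := ⊥

namespace ASC

variable {α : Type}

attribute [local instance] Classical.propDecidable

/-- The cone on the realization of a simplicial complex `K` (a topological model for a
simple polytope whose boundary is dual to `K`). -/
def coneRealization [Fintype α] (K : ASC α) : Type :=
  {f : α → ℝ // (∀ a, 0 ≤ f a) ∧ (∑ a, f a) ≤ 1 ∧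
    (Finset.univ.filter fun a => f a ≠ 0) ∈ K.faces}

instance [Fintype α] (K : ASC α) : TopologicalSpace K.coneRealization :=
  inferInstanceAs (TopologicalSpace {f : α → ℝ // _})

/-- The real toric space associated with a simple polytope (modelled as the cone on the
dual complex `K` of its boundary) and a mod 2 characteristic function `lam`:
the quotient of `P × ℤ₂^m` identifying `(p, g)` and `(p, h)` whenever `g - h` lies in the
span of the characteristic vectors of the facets containing `p`. -/
def RealToric [Fintype α] (K : ASC α) (m : Type) (lam : α → m → ZMod 2) : Type :=
  Quot (fun p q : K.coneRealization × (m → ZMod 2) =>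
    p.1 = q.1 ∧ p.2 - q.2 ∈ Submodule.span (ZMod 2) (lam '' {a | p.1.1 a ≠ 0}))

instance [Fintype α] (K : ASC α) (m : Type) (lam : α → m → ZMod 2) :
    TopologicalSpace (RealToric K m lam) :=
  inferInstanceAs (TopologicalSpace (Quot _))

end ASC

namespace PSG

variable {V E : Type} [Fintype V] [Fintype E] [DecidableEq V] [DecidableEq E] {A : Amb V E}

attribute [local instance] Classical.propDecidable

/-- The index set `R_G` of the characteristic function: the nodes other than the chosen
representative of their component, and the multiple edges other than the chosen
representative of their bundle. -/
def RG (G : PSG A) (nodeRep : V → V) (edgeRep : E → E) : Type :=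
  {v : V // v ∈ G.verts ∧ nodeRep v ≠ v} ⊕ {e : E // MultipleIn G e ∧ edgeRep e ≠ e}

/-- The mod 2 characteristic function of the canonical Delzant realization of the
pseudograph associahedron `P_G`, evaluated on the facet corresponding to a tube `I`. -/
def lamG (G : PSG A) (nodeRep : V → V) (edgeRep : E → E) (I : PSG A) :
    RG G nodeRep edgeRep → ZMod 2 := fun r =>
  match r with
  | Sum.inl v => (if v.1 ∈ I.verts then 1 else 0) + (if nodeRep v.1 ∈ I.verts then 1 else 0)
  | Sum.inr e => (if e.1 ∈ I.edges then 1 else 0) + (if edgeRep e.1 ∈ I.edges then 1 else 0)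

/-- `nodeRep` picks a distinguished node in each connected component of `G`, and
`edgeRep` picks a distinguished edge in each bundle of `G`. -/
def GoodReps (G : PSG A) (nodeRep : V → V) (edgeRep : E → E) : Prop :=
  (∀ v ∈ G.verts, nodeRep v ∈ G.verts ∧ reachIn G v (nodeRep v)) ∧
    (∀ v ∈ G.verts, ∀ w ∈ G.verts, reachIn G v w → nodeRep v = nodeRep w) ∧
    (∀ e, MultipleIn G e → MultipleIn G (edgeRep e) ∧ A.ends (edgeRep e) = A.ends e) ∧
    ∀ e e', MultipleIn G e → MultipleIn G e' → A.ends e = A.ends e' → edgeRep e = edgeRep e'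

/-- The real toric manifold `M_G` associated with the canonical Delzant realization of
the pseudograph associahedron `P_G`. -/
def MG (G : PSG A) (nodeRep : V → V) (edgeRep : E → E) : Type :=
  ASC.RealToric (tubingComplex G) (RG G nodeRep edgeRep) (lamG G nodeRep edgeRep)

instance (G : PSG A) (nodeRep : V → V) (edgeRep : E → E) :
    TopologicalSpace (MG G nodeRep edgeRep) :=
  inferInstanceAs (TopologicalSpace (ASC.RealToric _ _ _))

end PSG

/-- The ambient structure for the pseudograph with three nodes `1, 2, 3`, a bundle
`{a, b}` between nodes `1` and `2`, and a simple edge between nodes `2` and `3`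
(here nodes are `0, 1, 2 : Fin 3` and the edges `a, b, c` are `0, 1, 2 : Fin 3`,
with `a, b` joining the nodes `0, 1` and `c` joining the nodes `1, 2`). -/
def ambEx : Amb (Fin 3) (Fin 3) where
  ends := ![s(0, 1), s(0, 1), s(1, 2)]
  noLoop := by decide

/-- The pseudograph `G` of Example: all three nodes and all three edges. -/
def pgEx : PSG ambEx where
  verts := Finset.univ
  edges := Finset.univ
  incl := fun _ _ v _ => Finset.mem_univ v

namespace Sing

/-! ### Augmented singular chains -/

/-- The standard simplex with `n` vertices. -/
abbrev Spx (n : ℕ) : Type := stdSimplex ℝ (Fin n)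

/-- Singular chains spanned by simplices with `n` vertices; the degree `0` part is spanned by the
empty simplex, so that this is the augmented singular chain complex. -/
abbrev Ch (n : ℕ) (X : Type) [TopologicalSpace X] : Type := C(Spx n, X) →₀ ℚ

/-- The inclusion of the face opposite to the vertex `i`. -/
noncomputable def face {n : ℕ} (i : Fin (n + 1)) : C(Spx n, Spx (n + 1)) :=
  ⟨stdSimplex.map i.succAbove, stdSimplex.continuous_map _⟩

lemma face_succAbove {n : ℕ} (i : Fin (n + 1)) (t : Spx n) (j : Fin n) :
    face i t (i.succAbove j) = t j := by
  change FunOnFinite.linearMap ℝ ℝ i.succAbove t (i.succAbove j) = _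
  rw [FunOnFinite.linearMap_apply_apply]
  simp [Finset.filter_eq']

lemma face_self {n : ℕ} (i : Fin (n + 1)) (t : Spx n) : face i t i = 0 := by
  change FunOnFinite.linearMap ℝ ℝ i.succAbove t i = _
  rw [FunOnFinite.linearMap_apply_apply]
  apply Finset.sum_eq_zero
  intro j hj
  simp [Fin.succAbove_ne] at hj

lemma face_comp_face {n : ℕ} (i j : Fin (n + 1)) (h : i ≤ j) :
    (face j.succ).comp (face i) = (face i.castSucc).comp (face j) := by
  ext1 t
  change stdSimplex.map _ (stdSimplex.map _ t) = stdSimplex.map _ (stdSimplex.map _ t)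
  rw [stdSimplex.map_comp_apply, stdSimplex.map_comp_apply]
  congr 1
  funext k
  have h' : (i : ℕ) ≤ j := h
  ext
  simp only [Function.comp, Fin.succAbove, Fin.lt_def, Fin.val_castSucc, Fin.val_succ]
  split_ifs <;> simp_all <;> omega

variable {X Y Z : Type} [TopologicalSpace X] [TopologicalSpace Y] [TopologicalSpace Z]

/-- The chain map induced by a continuous map. -/
noncomputable def push (n : ℕ) (f : C(X, Y)) : Ch n X →ₗ[ℚ] Ch n Y :=
  Finsupp.lmapDomain ℚ ℚ fun s => f.comp s

/-- Precomposition of singular simplices with a map of standard simplices. -/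
noncomputable def pull {m n : ℕ} (f : C(Spx m, Spx n)) : Ch n X →ₗ[ℚ] Ch m X :=
  Finsupp.lmapDomain ℚ ℚ fun s => s.comp f

/-- The boundary operator. -/
noncomputable def bd (n : ℕ) : Ch (n + 1) X →ₗ[ℚ] Ch n X :=
  ∑ i : Fin (n + 1), (-1 : ℚ) ^ (i : ℕ) • pull (face i)

@[simp] lemma push_single {n : ℕ} (f : C(X, Y)) (s : C(Spx n, X)) (a : ℚ) :
    push n f (Finsupp.single s a) = Finsupp.single (f.comp s) a :=
  Finsupp.mapDomain_single

@[simp] lemma pull_single {m n : ℕ} (f : C(Spx m, Spx n)) (s : C(Spx n, X)) (a : ℚ) :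
    pull f (Finsupp.single s a) = Finsupp.single (s.comp f) a :=
  Finsupp.mapDomain_single

lemma bd_apply {n : ℕ} (z : Ch (n + 1) X) :
    bd n z = ∑ i : Fin (n + 1), (-1 : ℚ) ^ (i : ℕ) • pull (face i) z := by
  simp [bd]

lemma bd_single {n : ℕ} (s : C(Spx (n + 1), X)) (a : ℚ) :
    bd n (Finsupp.single s a) =
      ∑ i : Fin (n + 1), (-1 : ℚ) ^ (i : ℕ) • Finsupp.single (s.comp (face i)) a := by
  simp [bd_apply]

lemma ch_ext {n : ℕ} {M : Type} [AddCommGroup M] [Module ℚ M] {f g : Ch n X →ₗ[ℚ] M}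
    (h : ∀ s, f (Finsupp.single s 1) = g (Finsupp.single s 1)) : f = g :=
  Finsupp.lhom_ext' fun s => LinearMap.ext_ring (h s)

lemma push_comp {n : ℕ} (f : C(X, Y)) (g : C(Y, Z)) (z : Ch n X) :
    push n g (push n f z) = push n (g.comp f) z :=
  LinearMap.congr_fun (f := (push n g).comp (push n f))
    (ch_ext fun s => by simp [ContinuousMap.comp_assoc]) z

lemma push_pull {m n : ℕ} (f : C(Spx m, Spx n)) (g : C(X, Y)) (z : Ch n X) :
    push m g (pull f z) = pull f (push n g z) :=
  LinearMap.congr_fun (f := (push m g).comp (pull f)) (g := (pull f).comp (push n g))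
    (ch_ext fun s => by simp [ContinuousMap.comp_assoc]) z

lemma push_bd {n : ℕ} (f : C(X, Y)) (z : Ch (n + 1) X) :
    push n f (bd n z) = bd n (push (n + 1) f z) := by
  simp [bd_apply, push_pull]

lemma bd_bd {n : ℕ} (z : Ch (n + 2) X) : bd n (bd (n + 1) z) = 0 := by
  refine LinearMap.congr_fun (f := (bd n).comp (bd (n + 1))) (g := 0) (ch_ext fun s => ?_) z
  simp only [LinearMap.comp_apply, bd_single, map_sum, map_smul, Finset.smul_sum,
    LinearMap.zero_apply, ← Finset.sum_product', smul_smul, ContinuousMap.comp_assoc]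
  let P := Fin (n + 2) × Fin (n + 1)
  let S : Finset P := {ij : P | (ij.1 : ℕ) ≤ (ij.2 : ℕ)}
  rw [Finset.univ_product_univ, ← Finset.sum_add_sum_compl S, ← eq_neg_iff_add_eq_zero,
    ← Finset.sum_neg_distrib]
  let φ : ∀ ij : P, ij ∈ S → P := fun ij hij =>
    (ij.2.succ, Fin.castLT ij.1 (lt_of_le_of_lt (Finset.mem_filter.mp hij).right (Fin.is_lt ij.2)))
  apply Finset.sum_bij φ
  · intro ij hij
    simp_rw [S, φ, Finset.compl_filter, Finset.mem_filter_univ, Fin.val_succ,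
      Fin.val_castLT] at hij ⊢
    lia
  · rintro ⟨i, j⟩ hij ⟨i', j'⟩ hij' h
    rw [Prod.mk_inj]
    exact ⟨by simpa [φ, Fin.castSucc_castLT] using congr_arg Fin.castSucc (congr_arg Prod.snd h),
      by simpa [φ] using congr_arg Prod.fst h⟩
  · rintro ⟨i', j'⟩ hij'
    simp_rw [S, Finset.compl_filter, Finset.mem_filter_univ, not_le] at hij'
    refine ⟨(Fin.castSucc j', i'.pred <| ?_), ?_, ?_⟩
    · rintro rfl
      simp at hij'
    · simpa [S] using Nat.le_sub_one_of_lt hij'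
    · simp only [φ, Fin.castLT_castSucc, Fin.succ_pred]
  · rintro ⟨i, j⟩ hij
    have hij' : (i : ℕ) ≤ j := by simpa [S] using hij
    obtain ⟨i, rfl⟩ : ∃ i' : Fin (n + 1), i = i'.castSucc :=
      ⟨Fin.castLT i (lt_of_le_of_lt hij' j.is_lt), by simp⟩
    dsimp only [φ]
    rw [Fin.castLT_castSucc, face_comp_face i j hij', ← neg_smul]
    congr 1
    simp only [Fin.val_succ, Fin.val_castSucc, pow_succ]
    ring

end Sing

namespace Sing

variable {X Y Z : Type} [TopologicalSpace X] [TopologicalSpace Y] [TopologicalSpace Z]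

lemma map_mem_of_supported {n : ℕ} {M : Type} [AddCommGroup M] [Module ℚ M]
    (L : Ch n X →ₗ[ℚ] M) (P : Submodule ℚ M) {S : Set C(Spx n, X)}
    (h : ∀ s ∈ S, L (Finsupp.single s 1) ∈ P) {z : Ch n X} (hz : z ∈ Finsupp.supported ℚ ℚ S) :
    L z ∈ P := by
  rw [Finsupp.supported_eq_span_single] at hz
  refine (Submodule.span_le (p := P.comap L)).2 ?_ hz
  rintro _ ⟨s, hs, rfl⟩
  exact h s hs

/-! ### Cones -/

section Cone

variable {W : Type} [NormedAddCommGroup W] [NormedSpace ℝ W]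

/-- The projection of a point of a simplex to the face opposite to the vertex `0`. -/
noncomputable def tail {n : ℕ} (t : Spx (n + 1)) (h : t 0 ≠ 1) : Spx n :=
  ⟨fun j => t j.succ / (1 - t 0), by
    have h1 : 0 < 1 - t 0 := sub_pos.2 (lt_of_le_of_ne (stdSimplex.le_one t 0) h)
    refine ⟨fun j => div_nonneg (t.2.1 _) h1.le, ?_⟩
    rw [← Finset.sum_div, div_eq_one_iff_eq h1.ne', eq_sub_iff_add_eq']
    rw [← Fin.sum_univ_succ (f := fun i => t i)]
    exact t.2.2⟩

lemma tail_apply {n : ℕ} (t : Spx (n + 1)) (h : t 0 ≠ 1) (j : Fin n) :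
    tail t h j = t j.succ / (1 - t 0) := rfl

lemma continuous_coord {n : ℕ} (i : Fin n) : Continuous fun t : Spx n => t i :=
  (continuous_apply i).comp continuous_subtype_val

/-- The cone from the point `q` over a singular simplex in a normed space. -/
noncomputable def coneFun {n : ℕ} (q : W) (s : C(Spx n, W)) (t : Spx (n + 1)) : W :=
  t 0 • q + if h : t 0 ≠ 1 then (1 - t 0) • s (tail t h) else 0

lemma continuous_coneFun {n : ℕ} (q : W) (s : C(Spx n, W)) : Continuous (coneFun q s) := by
  refine ((continuous_coord 0).smul continuous_const).add ?_
  rw [continuous_iff_continuousAt]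
  intro t
  by_cases ht : t 0 = 1
  · obtain ⟨M, hM⟩ := (isCompact_range s.continuous).isBounded.exists_norm_le
    have key : ∀ t : Spx (n + 1),
        ‖(if h : t 0 ≠ 1 then (1 - t 0) • s (tail t h) else 0)‖ ≤ (1 - t 0) * M := by
      intro t
      split_ifs with h
      · rw [norm_smul, Real.norm_of_nonneg (sub_nonneg.2 (stdSimplex.le_one t 0))]
        exact mul_le_mul_of_nonneg_left (hM _ ⟨_, rfl⟩) (sub_nonneg.2 (stdSimplex.le_one t 0))
      · simp [not_not.1 h]
    rw [ContinuousAt, dif_neg (not_not.2 ht)]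
    refine squeeze_zero_norm key ?_
    have : Continuous fun t : Spx (n + 1) => (1 - t 0) * M :=
      (continuous_const.sub (continuous_coord 0)).mul continuous_const
    simpa [ht] using this.tendsto t
  · have ho : IsOpen {t : Spx (n + 1) | t 0 ≠ 1} :=
      isOpen_ne_fun (continuous_coord 0) continuous_const
    refine ContinuousOn.continuousAt (s := {t | t 0 ≠ 1}) ?_ (ho.mem_nhds ht)
    rw [continuousOn_iff_continuous_domRestrict]
    have : Set.domRestrict {t : Spx (n + 1) | t 0 ≠ 1}
        (fun t => if h : t 0 ≠ 1 then (1 - t 0) • s (tail t h) else 0) =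
        fun t => (1 - t.1 0) • s (tail t.1 t.2) := by
      funext t
      simp only [Set.domRestrict_apply]
      rw [dif_pos (show t.1 0 ≠ 1 from t.2)]
    rw [this]
    have h0 : Continuous fun t : {t : Spx (n + 1) | t 0 ≠ 1} => t.1 0 :=
      (continuous_coord 0).comp continuous_subtype_val
    refine (continuous_const.sub h0).smul (s.continuous.comp ?_)
    refine Continuous.subtype_mk (continuous_pi fun j => ?_) _
    exact ((continuous_coord j.succ).comp continuous_subtype_val).div
      (continuous_const.sub h0) fun t => sub_ne_zero.2 (Ne.symm t.2)

/-- A family of cone operators on singular simplices. -/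
structure ConeOp (X : Type) [TopologicalSpace X] where
  cone : ∀ {n : ℕ}, C(Spx n, X) → C(Spx (n + 1), X)
  comp_zero : ∀ {n : ℕ} (s : C(Spx n, X)), (cone s).comp (face 0) = s
  comp_succ : ∀ {n : ℕ} (s : C(Spx (n + 1), X)) (i : Fin (n + 1)),
    (cone s).comp (face i.succ) = cone (s.comp (face i))

/-- The cone operator in a normed space. -/
noncomputable def linCone (q : W) : ConeOp W where
  cone s := ⟨coneFun q s, continuous_coneFun q s⟩
  comp_zero s := by
    ext1 t
    have h0 : face 0 t 0 = 0 := face_self 0 t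
    have h1 : face 0 t 0 ≠ 1 := by simp [h0]
    change face 0 t 0 • q + _ = _
    rw [dif_pos h1, h0, zero_smul, zero_add, sub_zero, one_smul]
    congr 1
    ext j
    rw [tail_apply, h0, ← Fin.succAbove_zero_apply, face_succAbove]
    simp
  comp_succ s i := by
    ext1 t
    have h0 : face i.succ t 0 = t 0 := by
      conv_lhs => rw [← Fin.succ_succAbove_zero i]
      exact face_succAbove _ _ _
    change face i.succ t 0 • q + _ = t 0 • q + _
    refine congrArg₂ (· + ·) (by rw [h0]) ?_
    by_cases h : t 0 ≠ 1
    · rw [dif_pos h, dif_pos (h0 ▸ h)]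
      refine congrArg₂ (· • ·) (by rw [h0]) ?_
      change s _ = s _
      congr 1
      ext k
      obtain rfl | ⟨j, rfl⟩ := Fin.eq_self_or_eq_succAbove i k
      · rw [face_self, tail_apply, face_self, zero_div]
      · rw [face_succAbove, tail_apply, tail_apply, h0, ← Fin.succ_succAbove_succ, face_succAbove]
    · rw [dif_neg h, dif_neg (h0 ▸ h)]

lemma linCone_apply {n : ℕ} (q : W) (s : C(Spx n, W)) (t : Spx (n + 1)) :
    (linCone q).cone s t = t 0 • q + if h : t 0 ≠ 1 then (1 - t 0) • s (tail t h) else 0 := rfl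

lemma linCone_mem {n : ℕ} {q : W} {A : Set W} (hq : q ∈ A)
    (hA : ∀ p ∈ A, ∀ r : ℝ, 0 ≤ r → r < 1 → r • q + (1 - r) • p ∈ A)
    {s : C(Spx n, W)} (hs : ∀ t, s t ∈ A) (t : Spx (n + 1)) : (linCone q).cone s t ∈ A := by
  rw [linCone_apply]
  split_ifs with h
  · exact hA _ (hs _) _ (t.2.1 0) (lt_of_le_of_ne (stdSimplex.le_one t 0) h)
  · simpa [not_not.1 h] using hq

/-- The cone operator in a standard simplex. -/
noncomputable def spxCone {m : ℕ} (b : Spx m) : ConeOp (Spx m) where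
  cone s := ⟨fun t => ⟨(linCone b.1).cone ((⟨Subtype.val, continuous_subtype_val⟩ :
      C(Spx m, Fin m → ℝ)).comp s) t,
    linCone_mem (A := stdSimplex ℝ (Fin m)) b.2
      (fun p hp r h0 h1 => convex_stdSimplex ℝ (Fin m) b.2 hp h0 (sub_nonneg.2 h1.le) (by ring))
      (fun t => (s t).2) t⟩, (ContinuousMap.continuous _).subtype_mk _⟩
  comp_zero s := by
    ext1 t
    exact Subtype.ext (DFunLike.congr_fun ((linCone b.1).comp_zero
      ((⟨Subtype.val, continuous_subtype_val⟩ : C(Spx m, Fin m → ℝ)).comp s)) t)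
  comp_succ s i := by
    ext1 t
    exact Subtype.ext (DFunLike.congr_fun ((linCone b.1).comp_succ
      ((⟨Subtype.val, continuous_subtype_val⟩ : C(Spx m, Fin m → ℝ)).comp s) i) t)

/-- The cone operator on chains. -/
noncomputable def ConeOp.ch (c : ConeOp X) (n : ℕ) : Ch n X →ₗ[ℚ] Ch (n + 1) X :=
  Finsupp.lmapDomain ℚ ℚ c.cone

@[simp] lemma ConeOp.ch_single (c : ConeOp X) {n : ℕ} (s : C(Spx n, X)) (a : ℚ) :
    c.ch n (Finsupp.single s a) = Finsupp.single (c.cone s) a :=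
  Finsupp.mapDomain_single

lemma ConeOp.bd_ch_zero (c : ConeOp X) (z : Ch 0 X) : bd 0 (c.ch 0 z) = z := by
  refine LinearMap.congr_fun (f := (bd 0).comp (c.ch 0)) (g := LinearMap.id)
    (ch_ext fun s => ?_) z
  simp [bd_single, c.comp_zero]

lemma ConeOp.bd_ch_succ (c : ConeOp X) {n : ℕ} (z : Ch (n + 1) X) :
    bd (n + 1) (c.ch (n + 1) z) = z - c.ch n (bd n z) := by
  refine LinearMap.congr_fun (f := (bd (n + 1)).comp (c.ch (n + 1)))
    (g := LinearMap.id - (c.ch n).comp (bd n)) (ch_ext fun s => ?_) z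
  simp [bd_single, c.comp_zero, c.comp_succ, Fin.sum_univ_succ (n := n + 1), pow_succ,
    sub_eq_add_neg]

end Cone

/-! ### Barycentric subdivision -/

/-- The barycenter of a simplex. -/
noncomputable def bary (n : ℕ) : Spx (n + 1) :=
  ⟨fun _ => 1 / ((n : ℝ) + 1), fun _ => by positivity, by
    simp; field_simp⟩

/-- The subdivision of the standard simplex. -/
noncomputable def sdChain : ∀ n, Ch n (Spx n)
  | 0 => Finsupp.single (ContinuousMap.id _) 1
  | n + 1 => (spxCone (bary n)).ch n
      (∑ i : Fin (n + 1), (-1 : ℚ) ^ (i : ℕ) • push n (face i) (sdChain n))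

/-- The subdivision operator. -/
noncomputable def sd (n : ℕ) : Ch n X →ₗ[ℚ] Ch n X :=
  Finsupp.linearCombination ℚ fun s => push n s (sdChain n)

/-- The chain homotopy between the identity and the subdivision, on the standard simplex. -/
noncomputable def htChain : ∀ n, Ch (n + 1) (Spx n)
  | 0 => 0
  | n + 1 => (spxCone (bary n)).ch (n + 1) (Finsupp.single (ContinuousMap.id _) 1 - sdChain (n + 1)
      - ∑ i : Fin (n + 1), (-1 : ℚ) ^ (i : ℕ) • push (n + 1) (face i) (htChain n))

/-- The chain homotopy between the identity and the subdivision. -/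
noncomputable def ht (n : ℕ) : Ch n X →ₗ[ℚ] Ch (n + 1) X :=
  Finsupp.linearCombination ℚ fun s => push (n + 1) s (htChain n)

@[simp] lemma sd_single {n : ℕ} (s : C(Spx n, X)) (a : ℚ) :
    sd n (Finsupp.single s a) = a • push n s (sdChain n) :=
  Finsupp.linearCombination_single _ _ _

@[simp] lemma ht_single {n : ℕ} (s : C(Spx n, X)) (a : ℚ) :
    ht n (Finsupp.single s a) = a • push (n + 1) s (htChain n) :=
  Finsupp.linearCombination_single _ _ _

lemma push_sd {n : ℕ} (f : C(X, Y)) (z : Ch n X) : push n f (sd n z) = sd n (push n f z) :=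
  LinearMap.congr_fun (f := (push n f).comp (sd n)) (g := (sd n).comp (push n f))
    (ch_ext fun s => by simp [push_comp]) z

lemma push_ht {n : ℕ} (f : C(X, Y)) (z : Ch n X) :
    push (n + 1) f (ht n z) = ht n (push n f z) :=
  LinearMap.congr_fun (f := (push (n + 1) f).comp (ht n)) (g := (ht n).comp (push n f))
    (ch_ext fun s => by simp [push_comp]) z

/-- The identity of the standard simplex, as a chain. -/
noncomputable abbrev idChain (n : ℕ) : Ch n (Spx n) := Finsupp.single (ContinuousMap.id _) 1

lemma sdChain_succ (n : ℕ) :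
    sdChain (n + 1) = (spxCone (bary n)).ch n (sd n (bd n (idChain (n + 1)))) := by
  simp [sdChain, bd_single]

lemma htChain_succ (n : ℕ) :
    htChain (n + 1) = (spxCone (bary n)).ch (n + 1)
      (idChain (n + 1) - sdChain (n + 1) - ht n (bd n (idChain (n + 1)))) := by
  simp [htChain, bd_single]

lemma push_idChain {n : ℕ} (s : C(Spx n, X)) : push n s (idChain n) = Finsupp.single s 1 := by
  simp

lemma bd_sd {n : ℕ} (z : Ch (n + 1) X) : bd n (sd (n + 1) z) = sd n (bd n z) := by
  induction n generalizing X with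
  | zero =>
    refine LinearMap.congr_fun (f := (bd 0).comp (sd 1)) (g := (sd 0).comp (bd 0))
      (ch_ext fun s => ?_) z
    rw [LinearMap.comp_apply, LinearMap.comp_apply, sd_single, one_smul, ← push_bd, sdChain_succ,
      ConeOp.bd_ch_zero, push_sd, push_bd, push_idChain]
  | succ n ih =>
    refine LinearMap.congr_fun (f := (bd (n + 1)).comp (sd (n + 2)))
      (g := (sd (n + 1)).comp (bd (n + 1))) (ch_ext fun s => ?_) z
    rw [LinearMap.comp_apply, LinearMap.comp_apply, sd_single, one_smul, ← push_bd, sdChain_succ,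
      ConeOp.bd_ch_succ, ih, bd_bd, map_zero, map_zero, sub_zero, push_sd, push_bd, push_idChain]

lemma sd_zero (z : Ch 0 X) : sd 0 z = z :=
  LinearMap.congr_fun (f := sd 0) (g := LinearMap.id) (ch_ext fun s => by simp [sdChain]) z

lemma ht_zero (z : Ch 0 X) : ht 0 z = 0 :=
  LinearMap.congr_fun (f := ht 0) (g := 0) (ch_ext fun s => by simp [htChain]) z

lemma bd_ht_succ {n : ℕ} (z : Ch (n + 1) X) :
    bd (n + 1) (ht (n + 1) z) = z - sd (n + 1) z - ht n (bd n z) := by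
  have key : ∀ n : ℕ, (∀ w : Ch (n + 1) (Spx (n + 1)),
      bd n (w - sd (n + 1) w - ht n (bd n w)) = 0) → ∀ (X : Type) [TopologicalSpace X]
      (z : Ch (n + 1) X), bd (n + 1) (ht (n + 1) z) = z - sd (n + 1) z - ht n (bd n z) := by
    intro n hw X _ z
    refine LinearMap.congr_fun (f := (bd (n + 1)).comp (ht (n + 1)))
      (g := LinearMap.id - sd (n + 1) - (ht n).comp (bd n)) (ch_ext fun s => ?_) z
    have hw := hw (idChain (n + 1))
    rw [sd_single, one_smul, show push (n + 1) (ContinuousMap.id (Spx (n + 1)))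
      (sdChain (n + 1)) = sdChain (n + 1) from Finsupp.mapDomain_id] at hw
    simp only [LinearMap.comp_apply, LinearMap.sub_apply, LinearMap.id_apply]
    rw [ht_single, one_smul, ← push_bd, htChain_succ, ConeOp.bd_ch_succ, hw, map_zero, sub_zero,
      map_sub, map_sub, push_ht, push_bd, push_idChain, sd_single, one_smul]
  induction n generalizing X with
  | zero => exact key 0 (fun w => by simp [bd_sd, ht_zero, sd_zero]) X z
  | succ n ih =>
    exact key (n + 1) (fun w => by simp [bd_sd, ih, bd_bd]) X z

end Sing

namespace Sing

variable {X Y Z : Type} [TopologicalSpace X] [TopologicalSpace Y] [TopologicalSpace Z]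

/-! ### Small simplices -/

/-- The map is affine, and its vertices are at mutual `ℓ¹`-distance at most `2 * r`. -/
def IsAff {m n : ℕ} (r : ℝ) (f : C(Spx n, Spx m)) : Prop :=
  ∃ w : Fin n → Spx m, (∀ t i, f t i = ∑ j, t j * w j i) ∧
    ∀ j k, ∑ i, |w j i - w k i| ≤ 2 * r

/-- The map is Lipschitz with constant `r` for the `ℓ¹`-distance. -/
def IsLip {m n : ℕ} (r : ℝ) (f : C(Spx n, Spx m)) : Prop :=
  ∀ x y, ∑ i, |f x i - f y i| ≤ r * ∑ j, |x j - y j|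

lemma sum_abs_le_of_sum_eq_zero {n m : ℕ} {r : ℝ} (w : Fin n → Fin m → ℝ)
    (hw : ∀ j k, ∑ i, |w j i - w k i| ≤ 2 * r) (d : Fin n → ℝ) (hd : ∑ j, d j = 0) :
    ∑ i, |∑ j, d j * w j i| ≤ r * ∑ j, |d j| := by
  set P := ∑ j, (d j)⁺ with hP
  have hN : ∑ j, (d j)⁻ = P := by
    have : ∑ j, ((d j)⁺ - (d j)⁻) = 0 := by simpa only [posPart_sub_negPart] using hd
    rw [Finset.sum_sub_distrib] at this
    linarith
  have hA : ∑ j, |d j| = 2 * P := by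
    simp only [← posPart_add_negPart, Finset.sum_add_distrib, hN]
    rw [← hP]; ring
  have hP0 : 0 ≤ P := Finset.sum_nonneg fun j _ => posPart_nonneg _
  rcases hP0.eq_or_lt with h0 | h0
  · have h1 : ∀ j, d j = 0 := fun j => by
      rw [← h0, mul_zero] at hA
      exact abs_eq_zero.1 ((Finset.sum_eq_zero_iff_of_nonneg fun j _ => abs_nonneg _).1 hA j
        (Finset.mem_univ j))
    simp [h1]
  · refine le_of_mul_le_mul_left ?_ h0
    have h2 : ∀ i, P * ∑ j, d j * w j i = ∑ j, ∑ k, (d j)⁺ * (d k)⁻ * (w j i - w k i) := by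
      intro i
      simp only [mul_sub, Finset.sum_sub_distrib]
      have e1 : ∑ j, ∑ k, (d j)⁺ * (d k)⁻ * w j i = P * ∑ j, (d j)⁺ * w j i := by
        rw [← hN, Finset.sum_mul_sum, Finset.sum_comm]
        exact Finset.sum_congr rfl fun _ _ => Finset.sum_congr rfl fun _ _ => by ring
      have e2 : ∑ j, ∑ k, (d j)⁺ * (d k)⁻ * w k i = P * ∑ j, (d j)⁻ * w j i := by
        rw [hP, Finset.sum_mul_sum]
        exact Finset.sum_congr rfl fun _ _ => Finset.sum_congr rfl fun _ _ => by ring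
      rw [e1, e2, ← mul_sub, ← Finset.sum_sub_distrib]
      congr 1
      exact Finset.sum_congr rfl fun j _ => by rw [← sub_mul, posPart_sub_negPart]
    calc P * ∑ i, |∑ j, d j * w j i| = ∑ i, |P * ∑ j, d j * w j i| := by
          rw [Finset.mul_sum]
          exact Finset.sum_congr rfl fun i _ => by rw [abs_mul, abs_of_pos h0]
      _ ≤ ∑ i, ∑ j, ∑ k, (d j)⁺ * (d k)⁻ * |w j i - w k i| := by
          refine Finset.sum_le_sum fun i _ => ?_
          rw [h2]
          refine (Finset.abs_sum_le_sum_abs _ _).trans (Finset.sum_le_sum fun j _ => ?_)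
          refine (Finset.abs_sum_le_sum_abs _ _).trans (Finset.sum_le_sum fun k _ => ?_)
          rw [abs_mul, abs_of_nonneg (mul_nonneg (posPart_nonneg _) (negPart_nonneg _))]
      _ = ∑ j, ∑ k, (d j)⁺ * (d k)⁻ * ∑ i, |w j i - w k i| := by
          rw [Finset.sum_comm]
          refine Finset.sum_congr rfl fun j _ => ?_
          rw [Finset.sum_comm]
          simp [Finset.mul_sum]
      _ ≤ ∑ j, ∑ k, (d j)⁺ * (d k)⁻ * (2 * r) :=
          Finset.sum_le_sum fun j _ => Finset.sum_le_sum fun k _ =>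
            mul_le_mul_of_nonneg_left (hw j k) (mul_nonneg (posPart_nonneg _) (negPart_nonneg _))
      _ = P * P * (2 * r) := by
          simp only [← Finset.sum_mul, ← Finset.mul_sum, hN]
          rw [← hP]
      _ = P * (r * ∑ j, |d j|) := by rw [hA]; ring

lemma IsAff.isLip {m n : ℕ} {r : ℝ} {f : C(Spx n, Spx m)} (h : IsAff r f) : IsLip r f := by
  obtain ⟨w, hf, hw⟩ := h
  intro x y
  have := sum_abs_le_of_sum_eq_zero (fun j i => w j i) hw (fun j => x j - y j) (by
    rw [Finset.sum_sub_distrib, stdSimplex.sum_eq_one, stdSimplex.sum_eq_one, sub_self])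
  simpa only [hf, ← Finset.sum_sub_distrib, ← sub_mul] using this

lemma IsLip.comp {l m n : ℕ} {r r' : ℝ} {f : C(Spx m, Spx n)} {g : C(Spx l, Spx m)}
    (hr : 0 ≤ r) (hf : IsLip r f) (hg : IsLip r' g) : IsLip (r * r') (f.comp g) := fun x y =>
  (hf _ _).trans (by rw [mul_assoc]; exact mul_le_mul_of_nonneg_left (hg x y) hr)

lemma IsAff.mono {m n : ℕ} {r r' : ℝ} {f : C(Spx n, Spx m)} (h : IsAff r f) (hr : r ≤ r') :
    IsAff r' f := by
  obtain ⟨w, hf, hw⟩ := h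
  exact ⟨w, hf, fun j k => (hw j k).trans (by linarith)⟩

lemma IsAff.face_comp {m n : ℕ} {r : ℝ} {f : C(Spx n, Spx m)} (h : IsAff r f)
    (i : Fin (m + 1)) : IsAff r ((face i).comp f) := by
  obtain ⟨w, hf, hw⟩ := h
  refine ⟨fun j => face i (w j), fun t k => ?_, fun j k => ?_⟩
  · rw [ContinuousMap.comp_apply]
    obtain rfl | ⟨k, rfl⟩ := Fin.eq_self_or_eq_succAbove i k
    · simp [face_self]
    · simp [face_succAbove, hf]
  · rw [Fin.sum_univ_succAbove _ i]
    simpa [face_self, face_succAbove] using hw j k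

lemma sum_abs_bary_sub {n : ℕ} (v : Spx (n + 1)) :
    ∑ i, |bary n i - v i| ≤ 2 * (1 - 1 / ((n : ℝ) + 2)) := by
  have hb : ∀ i, bary n i = 1 / ((n : ℝ) + 1) := fun _ => rfl
  have hn : 1 / ((n : ℝ) + 1) ≤ 1 := by
    rw [div_le_one (by positivity)]; linarith [(Nat.cast_nonneg n : (0 : ℝ) ≤ n)]
  have hn0 : 0 < 1 / ((n : ℝ) + 1) := by positivity
  have h : ∀ i, |bary n i - v i| ≤ bary n i + (1 - 2 * (1 / ((n : ℝ) + 1))) * v i := by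
    intro i
    have h0 : 0 ≤ v i := v.2.1 i
    have h1 := stdSimplex.le_one v i
    rw [hb, abs_le]
    constructor <;> nlinarith
  refine (Finset.sum_le_sum fun i _ => h i).trans ?_
  rw [Finset.sum_add_distrib, ← Finset.mul_sum, stdSimplex.sum_eq_one, stdSimplex.sum_eq_one]
  have : 1 / ((n : ℝ) + 2) ≤ 1 / ((n : ℝ) + 1) := by
    apply one_div_le_one_div_of_le <;> [positivity; linarith]
  linarith

lemma IsAff.cone {n : ℕ} {f : C(Spx n, Spx (n + 1))}
    (h : IsAff (1 - 1 / ((n : ℝ) + 2)) f) :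
    IsAff (1 - 1 / ((n : ℝ) + 2)) ((spxCone (bary n)).cone f) := by
  obtain ⟨w, hf, hw⟩ := h
  refine ⟨Fin.cons (bary n) w, fun t i => ?_, fun j k => ?_⟩
  · change (t 0 • (bary n).1 + if h : t 0 ≠ 1 then (1 - t 0) • (f (tail t h)).1 else 0) i = _
    rw [Fin.sum_univ_succ]
    simp only [Fin.cons_zero, Fin.cons_succ]
    refine congrArg₂ (fun a b : ℝ => a + b) rfl ?_
    split_ifs with h
    · change (1 - t 0) * f (tail t h) i = _
      rw [hf, Finset.mul_sum]
      refine Finset.sum_congr rfl fun j _ => ?_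
      have : 1 - t 0 ≠ 0 := sub_ne_zero.2 (Ne.symm h)
      rw [tail_apply]
      field_simp
    · have hs : ∑ j, t (Fin.succ j) = 0 := by
        have := stdSimplex.sum_eq_one t
        rw [Fin.sum_univ_succ, not_not.1 h] at this
        linarith
      have := (Finset.sum_eq_zero_iff_of_nonneg fun j _ => t.2.1 _).1 hs
      exact (Finset.sum_eq_zero fun j _ => by
        rw [show t j.succ = 0 from this j (Finset.mem_univ j), zero_mul]).symm
  · have hn : 1 / ((n : ℝ) + 2) ≤ 1 := by
      rw [div_le_one (by positivity)]; linarith [(Nat.cast_nonneg n : (0 : ℝ) ≤ n)]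
    refine Fin.cases ?_ (fun j => ?_) j <;> refine Fin.cases ?_ (fun k => ?_) k
    · simpa using hn
    · simpa using sum_abs_bary_sub (w k)
    · simpa [abs_sub_comm] using sum_abs_bary_sub (w j)
    · simpa using hw j k

lemma sdChain_mem (n : ℕ) :
    sdChain n ∈ Finsupp.supported ℚ ℚ {f : C(Spx n, Spx n) | IsAff (1 - 1 / ((n : ℝ) + 1)) f} := by
  induction n with
  | zero =>
    exact Finsupp.single_mem_supported ℚ _ ⟨Fin.elim0, fun t i => i.elim0, fun j => j.elim0⟩
  | succ n ih =>
    have hc : (((n + 1 : ℕ) : ℝ) + 1) = (n : ℝ) + 2 := by push_cast; ring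
    rw [hc]
    refine map_mem_of_supported ((spxCone (bary n)).ch n) _
      (S := {f | IsAff (1 - 1 / ((n : ℝ) + 2)) f}) (fun s hs => ?_) ?_
    · rw [ConeOp.ch_single]
      exact Finsupp.single_mem_supported ℚ _ (IsAff.cone hs)
    · refine Submodule.sum_mem _ fun i _ => Submodule.smul_mem _ _ ?_
      refine map_mem_of_supported (push n (face i)) _ (fun s hs => ?_) ih
      rw [push_single]
      refine Finsupp.single_mem_supported ℚ _ ((IsAff.mono hs ?_).face_comp i)
      have : 1 / ((n : ℝ) + 2) ≤ 1 / ((n : ℝ) + 1) := by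
        apply one_div_le_one_div_of_le <;> [positivity; linarith]
      linarith

lemma sd_iterate_idChain_mem (n k : ℕ) : (sd n)^[k] (idChain n) ∈
    Finsupp.supported ℚ ℚ {f : C(Spx n, Spx n) | IsLip ((1 - 1 / ((n : ℝ) + 1)) ^ k) f} := by
  have h0 : (0 : ℝ) ≤ 1 - 1 / ((n : ℝ) + 1) := by
    have : 1 / ((n : ℝ) + 1) ≤ 1 := by
      rw [div_le_one (by positivity)]; linarith [(Nat.cast_nonneg n : (0 : ℝ) ≤ n)]
    linarith
  induction k with
  | zero => exact Finsupp.single_mem_supported ℚ _ fun x y => by simp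
  | succ k ih =>
    rw [Function.iterate_succ_apply']
    refine map_mem_of_supported (sd n) _ (fun s hs => ?_) ih
    rw [sd_single, one_smul]
    refine map_mem_of_supported (push n s) _ (fun f hf => ?_) (sdChain_mem n)
    rw [push_single]
    refine Finsupp.single_mem_supported ℚ _ ?_
    rw [Set.mem_ofPred_eq, pow_succ]
    exact IsLip.comp (pow_nonneg h0 k) hs (IsAff.isLip hf)

/-- The simplex is contained in a member of the cover. -/
def IsSmall {n : ℕ} (c : Set (Set X)) (s : C(Spx n, X)) : Prop := ∃ U ∈ c, ∀ t, s t ∈ U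

lemma exists_sd_iterate_single_mem {n : ℕ} {c : Set (Set X)} (hc : c.Nonempty)
    (s : C(Spx n, X)) (ho : ∀ U ∈ c, IsOpen U) (hs : ∀ t, ∃ U ∈ c, s t ∈ U) :
    ∃ k₀, ∀ k ≥ k₀, (sd n)^[k] (Finsupp.single s 1) ∈
      Finsupp.supported ℚ ℚ {s : C(Spx n, X) | IsSmall c s} := by
  suffices h : ∃ k₀, ∀ k ≥ k₀, ∀ f : C(Spx n, Spx n), IsLip ((1 - 1 / ((n : ℝ) + 1)) ^ k) f →
      IsSmall c (s.comp f) by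
    obtain ⟨k₀, hk⟩ := h
    refine ⟨k₀, fun k hk₀ => ?_⟩
    have e : (sd n)^[k] (Finsupp.single s 1) = push n s ((sd n)^[k] (idChain n)) := by
      rw [(show Function.Semiconj (push n s) (sd n) (sd n) from push_sd s).iterate_right k,
        push_idChain]
    rw [e]
    refine map_mem_of_supported (push n s) _ (fun f hf => ?_) (sd_iterate_idChain_mem n k)
    rw [push_single]
    exact Finsupp.single_mem_supported ℚ _ (hk k hk₀ f hf)
  cases n with
  | zero =>
    obtain ⟨U, hU⟩ := hc
    exact ⟨0, fun k _ f _ => ⟨U, hU, fun t => absurd t.2.2 (by simp)⟩⟩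
  | succ n =>
    obtain ⟨ε, hε, H⟩ := lebesgue_number_lemma_of_metric_sUnion
      (s := (Set.univ : Set (Spx (n + 1))))
      (c := (s ⁻¹' ·) '' c) isCompact_univ
      (by rintro _ ⟨U, hU, rfl⟩; exact (ho U hU).preimage s.continuous)
      (fun t _ => by
        obtain ⟨U, hU, h⟩ := hs t
        exact ⟨_, ⟨U, hU, rfl⟩, h⟩)
    have hr0 : (0 : ℝ) ≤ 1 - 1 / (((n + 1 : ℕ) : ℝ) + 1) := by
      have : 1 / (((n + 1 : ℕ) : ℝ) + 1) ≤ 1 := by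
        rw [div_le_one (by positivity)]
        linarith [(Nat.cast_nonneg (n + 1) : (0 : ℝ) ≤ (n + 1 : ℕ))]
      linarith
    have hr1 : 1 - 1 / (((n + 1 : ℕ) : ℝ) + 1) < 1 := by
      have : 0 < 1 / (((n + 1 : ℕ) : ℝ) + 1) := by positivity
      linarith
    obtain ⟨k₀, hk₀⟩ := exists_pow_lt_of_lt_one (half_pos hε) hr1
    refine ⟨k₀, fun k hk f hf => ?_⟩
    obtain ⟨_, ⟨U, hU, rfl⟩, hb⟩ := H (f (bary n)) trivial
    refine ⟨U, hU, fun t => hb ?_⟩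
    have h1 : ∑ j, |t j - bary n j| ≤ 2 := by
      refine (Finset.sum_le_sum fun j _ => abs_sub _ _).trans ?_
      have ht : ∀ j, |t j| = t j := fun j => abs_of_nonneg (t.2.1 j)
      have hb : ∀ j, |bary n j| = bary n j := fun j => abs_of_nonneg ((bary n).2.1 j)
      simp only [ht, hb, Finset.sum_add_distrib, stdSimplex.sum_eq_one]
      norm_num
    have h2 := (pow_le_pow_of_le_one hr0 hr1.le hk).trans_lt hk₀
    have h3 := hf t (bary n)
    have h4 : ∑ i, |f t i - f (bary n) i| < ε := by
      nlinarith [pow_nonneg hr0 k]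
    rw [Metric.mem_ball, Subtype.dist_eq, dist_pi_lt_iff hε]
    intro i
    rw [Real.dist_eq]
    exact (Finset.single_le_sum (f := fun i => |f t i - f (bary n) i|) (fun _ _ => abs_nonneg _)
      (Finset.mem_univ i)).trans_lt h4

end Sing

namespace Sing

variable {X Y Z : Type} [TopologicalSpace X] [TopologicalSpace Y] [TopologicalSpace Z]

/-! ### Families of simplices and their homology -/

/-- A family of singular simplices closed under precomposition. -/
structure Fam (X : Type) [TopologicalSpace X] where
  mem : ∀ n, Set C(Spx n, X)
  comp_mem : ∀ {m n : ℕ} {s : C(Spx n, X)} (f : C(Spx m, Spx n)), s ∈ mem n → s.comp f ∈ mem m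

namespace Fam

/-- The chains spanned by a family. -/
noncomputable def C (F : Fam X) (n : ℕ) : Submodule ℚ (Ch n X) := Finsupp.supported ℚ ℚ (F.mem n)

/-- The simplices contained in a member of a cover. -/
def small (c : Set (Set X)) : Fam X where
  mem _ := {s | IsSmall c s}
  comp_mem := fun f ⟨U, hU, h⟩ => ⟨U, hU, fun t => h (f t)⟩

/-- The simplices contained in a subset. -/
def sing (A : Set X) : Fam X where
  mem _ := {s | ∀ t, s t ∈ A}
  comp_mem := fun f h t => h (f t)

instance : Max (Fam X) :=
  ⟨fun F G => ⟨fun n => F.mem n ∪ G.mem n, fun f h => h.imp (F.comp_mem f) (G.comp_mem f)⟩⟩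

instance : Min (Fam X) :=
  ⟨fun F G => ⟨fun n => F.mem n ∩ G.mem n, fun f h => ⟨F.comp_mem f h.1, G.comp_mem f h.2⟩⟩⟩

lemma C_sup (F G : Fam X) (n : ℕ) : (F ⊔ G).C n = F.C n ⊔ G.C n := Finsupp.supported_union _ _

lemma C_inf (F G : Fam X) (n : ℕ) : (F ⊓ G).C n = F.C n ⊓ G.C n := Finsupp.supported_inter _ _

lemma push_mem (F : Fam X) {m n : ℕ} {s : C(Spx n, X)} (hs : s ∈ F.mem n) (z : Ch m (Spx n)) :
    push m s z ∈ F.C m :=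
  map_mem_of_supported (push m s) _ (S := Set.univ)
    (fun f _ => by
      rw [push_single]
      exact Finsupp.single_mem_supported ℚ _ (F.comp_mem f hs)) (by simp)

lemma bd_mem (F : Fam X) {n : ℕ} {z : Ch (n + 1) X} (hz : z ∈ F.C (n + 1)) : bd n z ∈ F.C n :=
  map_mem_of_supported (bd n) _ (fun s hs => by
    rw [← push_idChain s, ← push_bd]; exact F.push_mem hs _) hz

lemma sd_mem (F : Fam X) {n : ℕ} {z : Ch n X} (hz : z ∈ F.C n) : sd n z ∈ F.C n :=
  map_mem_of_supported (sd n) _ (fun s hs => by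
    rw [sd_single, one_smul]; exact F.push_mem hs _) hz

lemma ht_mem (F : Fam X) {n : ℕ} {z : Ch n X} (hz : z ∈ F.C n) : ht n z ∈ F.C (n + 1) :=
  map_mem_of_supported (ht n) _ (fun s hs => by
    rw [ht_single, one_smul]; exact F.push_mem hs _) hz

lemma sd_iterate_mem (F : Fam X) {n : ℕ} {z : Ch n X} (hz : z ∈ F.C n) (k : ℕ) :
    (sd n)^[k] z ∈ F.C n := by
  induction k with
  | zero => exact hz
  | succ k ih => rw [Function.iterate_succ_apply']; exact F.sd_mem ih

end Fam

/-- The cycles of the augmented chain complex, as a submodule. -/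
noncomputable def cyc : ∀ n : ℕ, Submodule ℚ (Ch n X)
  | 0 => ⊤
  | n + 1 => LinearMap.ker (bd n)

lemma mem_cyc_succ {n : ℕ} {z : Ch (n + 1) X} : z ∈ cyc (n + 1) ↔ bd n z = 0 := LinearMap.mem_ker

lemma bd_mem_cyc {n : ℕ} (z : Ch (n + 1) X) : bd n z ∈ cyc n := by
  cases n with
  | zero => trivial
  | succ n => exact mem_cyc_succ.2 (bd_bd z)

lemma sd_mem_cyc {n : ℕ} {z : Ch n X} (hz : z ∈ cyc n) : sd n z ∈ cyc n := by
  cases n with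
  | zero => trivial
  | succ n => rw [mem_cyc_succ] at *; rw [bd_sd, hz, map_zero]

lemma bd_ht {n : ℕ} {z : Ch n X} (hz : z ∈ cyc n) : bd n (ht n z) = z - sd n z := by
  cases n with
  | zero => rw [ht_zero, sd_zero, map_zero, sub_self]
  | succ n => rw [bd_ht_succ, mem_cyc_succ.1 hz, map_zero, sub_zero]

namespace Fam

/-- The boundaries of chains of a family. -/
noncomputable def B (F : Fam X) (n : ℕ) : Submodule ℚ (Ch n X) := (F.C (n + 1)).map (bd n)

lemma sub_sd_iterate_mem_B (F : Fam X) {n : ℕ} {z : Ch n X} (hz : z ∈ F.C n) (hc : z ∈ cyc n)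
    (k : ℕ) : z - (sd n)^[k] z ∈ F.B n ∧ (sd n)^[k] z ∈ cyc n := by
  induction k with
  | zero => simpa using hc
  | succ k ih =>
    rw [Function.iterate_succ_apply']
    refine ⟨?_, sd_mem_cyc ih.2⟩
    rw [← sub_add_sub_cancel z ((sd n)^[k] z), ← bd_ht ih.2]
    exact add_mem ih.1 ⟨_, F.ht_mem (F.sd_iterate_mem hz k), rfl⟩

/-- The homology of the family vanishes, except for a line in degree `m` if `o = some m`. -/
structure HT (F : Fam X) (o : Option ℕ) : Prop where
  acyclic : ∀ n, o ≠ some n → F.C n ⊓ cyc n ≤ F.B n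
  generated : ∀ m, o = some m → ∃ z₀ ∈ F.C m ⊓ cyc m, z₀ ∉ F.B m ∧
    ∀ z ∈ F.C m ⊓ cyc m, ∃ c : ℚ, z - c • z₀ ∈ F.B m

/-- The inclusion of a subfamily induces an isomorphism in homology. -/
structure QI (F G : Fam X) : Prop where
  le : ∀ n, F.C n ≤ G.C n
  surj : ∀ n, ∀ z ∈ G.C n ⊓ cyc n, ∃ z' ∈ F.C n ⊓ cyc n, z - z' ∈ G.B n
  inj : ∀ n, ∀ z ∈ F.C n ⊓ cyc n, z ∈ G.B n → z ∈ F.B n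

lemma B_mono {F G : Fam X} (h : ∀ n, F.C n ≤ G.C n) (n : ℕ) : F.B n ≤ G.B n :=
  Submodule.map_mono (h _)

lemma QI.ht {F G : Fam X} (h : QI F G) {o : Option ℕ} (hF : F.HT o) : G.HT o where
  acyclic n hn z hz := by
    obtain ⟨z', hz', hb⟩ := h.surj n z hz
    rw [← sub_add_cancel z z']
    exact add_mem hb (B_mono h.le n (hF.acyclic n hn hz'))
  generated m hm := by
    obtain ⟨z₀, hz₀, hb, hg⟩ := hF.generated m hm
    refine ⟨z₀, ⟨h.le m hz₀.1, hz₀.2⟩, fun hz => hb (h.inj m z₀ hz₀ hz), fun z hz => ?_⟩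
    obtain ⟨z', hz', hzb⟩ := h.surj m z hz
    obtain ⟨c, hc⟩ := hg z' hz'
    refine ⟨c, ?_⟩
    rw [← sub_add_sub_cancel z z']
    exact add_mem hzb (B_mono h.le m hc)

lemma QI.ht' {F G : Fam X} (h : QI F G) {o : Option ℕ} (hG : G.HT o) : F.HT o where
  acyclic n hn z hz := h.inj n z hz (hG.acyclic n hn ⟨h.le n hz.1, hz.2⟩)
  generated m hm := by
    obtain ⟨z₀, hz₀, hb, hg⟩ := hG.generated m hm
    obtain ⟨z', hz', hzb⟩ := h.surj m z₀ hz₀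
    refine ⟨z', hz', fun hz => hb ?_, fun z hz => ?_⟩
    · rw [← sub_add_cancel z₀ z']
      exact add_mem hzb (B_mono h.le m hz)
    · obtain ⟨c, hc⟩ := hg z ⟨h.le m hz.1, hz.2⟩
      refine ⟨c, h.inj m _ (sub_mem hz (Submodule.smul_mem _ _ hz')) ?_⟩
      have : z - c • z' = (z - c • z₀) + c • (z₀ - z') := by rw [smul_sub]; abel
      rw [this]
      exact add_mem hc (Submodule.smul_mem _ _ hzb)

lemma exists_sd_iterate_mem {c : Set (Set X)} (hc : c.Nonempty) (ho : ∀ U ∈ c, IsOpen U) {n : ℕ}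
    {z : Ch n X} (hz : z ∈ (sing (⋃₀ c)).C n) : ∃ k₀, ∀ k ≥ k₀, (sd n)^[k] z ∈ (small c).C n := by
  have hl : ∀ k, (sd n : Ch n X →ₗ[ℚ] Ch n X)^[k] = ⇑((sd n : Ch n X →ₗ[ℚ] Ch n X) ^ k) :=
    fun k => (Module.End.coe_pow (sd n : Ch n X →ₗ[ℚ] Ch n X) k).symm
  rw [C, Finsupp.supported_eq_span_single] at hz
  induction hz using Submodule.span_induction with
  | mem x hx =>
    obtain ⟨s, hs, rfl⟩ := hx
    exact exists_sd_iterate_single_mem hc s ho hs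
  | zero => exact ⟨0, fun k _ => by rw [hl, map_zero]; exact zero_mem _⟩
  | add x y _ _ hx hy =>
    obtain ⟨k, hk⟩ := hx
    obtain ⟨l, hl'⟩ := hy
    refine ⟨max k l, fun j hj => ?_⟩
    rw [hl, map_add, ← hl]
    exact add_mem (hk j (le_of_max_le_left hj)) (hl' j (le_of_max_le_right hj))
  | smul a x _ hx =>
    obtain ⟨k, hk⟩ := hx
    refine ⟨k, fun j hj => ?_⟩
    rw [hl, map_smul, ← hl]
    exact Submodule.smul_mem _ _ (hk j hj)

/-- Small simplices compute the homology of the union of an open cover. -/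
lemma qi_small {c : Set (Set X)} (hc : c.Nonempty) (ho : ∀ U ∈ c, IsOpen U) :
    QI (small c) (sing (⋃₀ c)) where
  le n := Finsupp.supported_mono fun s ⟨U, hU, h⟩ t => ⟨U, hU, h t⟩
  surj n z hz := by
    obtain ⟨k, hk⟩ := exists_sd_iterate_mem hc ho hz.1
    have := (sing (⋃₀ c)).sub_sd_iterate_mem_B hz.1 hz.2 k
    exact ⟨_, ⟨hk k le_rfl, this.2⟩, this.1⟩
  inj n z hz hb := by
    obtain ⟨x, hx, rfl⟩ := hb
    obtain ⟨k, hk⟩ := exists_sd_iterate_mem hc ho hx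
    have h := ((small c).sub_sd_iterate_mem_B hz.1 hz.2 k).1
    rw [← sub_add_cancel (bd n x) ((sd n)^[k] (bd n x))]
    refine add_mem h ⟨(sd (n + 1))^[k] x, hk k le_rfl, ?_⟩
    exact (show Function.Semiconj (bd n) (sd (n + 1)) (sd n) from bd_sd).iterate_right k x

/-! ### Mayer–Vietoris -/

lemma mem_C_inf_of_add_eq {F G : Fam X} {n : ℕ} {a b : Ch n X} (ha : a ∈ F.C n) (hb : b ∈ G.C n)
    (h : a + b = 0) : a ∈ (F ⊓ G).C n := by
  rw [C_inf]
  refine ⟨ha, ?_⟩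
  rw [eq_neg_of_add_eq_zero_left h]
  exact neg_mem hb

lemma le_C_sup_left (F G : Fam X) (n : ℕ) : F.C n ≤ (F ⊔ G).C n := by
  rw [C_sup]; exact le_sup_left

lemma le_C_sup_right (F G : Fam X) (n : ℕ) : G.C n ≤ (F ⊔ G).C n := by
  rw [C_sup]; exact le_sup_right

lemma mem_C_inf {F G : Fam X} {n : ℕ} {z : Ch n X} :
    z ∈ (F ⊓ G).C n ↔ z ∈ F.C n ∧ z ∈ G.C n := by
  rw [C_inf]; rfl

lemma mem_C_sup {F G : Fam X} {n : ℕ} {z : Ch n X} :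
    z ∈ (F ⊔ G).C n ↔ ∃ a ∈ F.C n, ∃ b ∈ G.C n, a + b = z := by
  rw [C_sup]; exact Submodule.mem_sup

lemma HT.sup_of_acyclic {F G : Fam X} {o : Option ℕ} (hF : F.HT none) (hG : G.HT none)
    (hI : (F ⊓ G).HT o) : (F ⊔ G).HT (o.map Nat.succ) := by
  have hF' : ∀ n, ∀ a ∈ F.C n, a ∈ cyc n → a ∈ (F ⊔ G).B n := fun n a ha hc =>
    B_mono (le_C_sup_left F G) n (hF.acyclic n (by simp) ⟨ha, hc⟩)
  have hG' : ∀ n, ∀ a ∈ G.C n, a ∈ cyc n → a ∈ (F ⊔ G).B n := fun n a ha hc =>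
    B_mono (le_C_sup_right F G) n (hG.acyclic n (by simp) ⟨ha, hc⟩)
  have key : ∀ n, ∀ a ∈ F.C (n + 1), ∀ b ∈ G.C (n + 1), bd n (a + b) = 0 →
      bd n a ∈ (F ⊓ G).C n := fun n a ha b hb h =>
    mem_C_inf_of_add_eq (F.bd_mem ha) (G.bd_mem hb) (by rw [← map_add, h])
  constructor
  · rintro (_ | n) hn z ⟨hz, hc⟩
    · obtain ⟨a, ha, b, hb, rfl⟩ := mem_C_sup.1 hz
      exact add_mem (hF' 0 a ha trivial) (hG' 0 b hb trivial)
    · obtain ⟨a, ha, b, hb, rfl⟩ := mem_C_sup.1 hz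
      replace hc := mem_cyc_succ.1 hc
      obtain ⟨c, hcI, hcb⟩ := hI.acyclic n (fun h => hn (by rw [h]; rfl))
        ⟨key n a ha b hb hc, bd_mem_cyc a⟩
      obtain ⟨hcF, hcG⟩ := mem_C_inf.1 hcI
      rw [show a + b = (a - c) + (b + c) by abel]
      refine add_mem (hF' _ _ (sub_mem ha hcF) ?_) (hG' _ _ (add_mem hb hcG) ?_)
      · refine mem_cyc_succ.2 ?_
        rw [map_sub, hcb, sub_self]
      · refine mem_cyc_succ.2 ?_
        rw [map_add, hcb, add_comm, ← map_add, hc]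
  · rintro m' hm'
    obtain ⟨m, rfl, rfl⟩ := Option.map_eq_some_iff.1 hm'
    obtain ⟨z₀, ⟨hz₀, hc₀⟩, hb₀, hg⟩ := hI.generated m rfl
    obtain ⟨hzF, hzG⟩ := mem_C_inf.1 hz₀
    obtain ⟨x, hx, hxz⟩ := hF.acyclic m (by simp) ⟨hzF, hc₀⟩
    obtain ⟨y, hy, hyz⟩ := hG.acyclic m (by simp) ⟨hzG, hc₀⟩
    refine ⟨x - y, ⟨sub_mem (le_C_sup_left F G _ hx) (le_C_sup_right F G _ hy), ?_⟩, ?_, ?_⟩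
    · refine mem_cyc_succ.2 ?_
      rw [map_sub, hxz, hyz, sub_self]
    · rintro ⟨w, hw, hwb⟩
      obtain ⟨p, hp, q, hq, rfl⟩ := mem_C_sup.1 hw
      rw [map_add] at hwb
      have e : x - bd (m + 1) p = y + bd (m + 1) q := by
        rw [sub_eq_iff_eq_add, add_assoc, add_comm (bd (m + 1) q), hwb]; abel
      refine hb₀ ⟨x - bd (m + 1) p, mem_C_inf.2 ⟨sub_mem hx (F.bd_mem hp), ?_⟩, ?_⟩
      · rw [e]; exact add_mem hy (G.bd_mem hq)
      · rw [map_sub, hxz, bd_bd, sub_zero]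
    · rintro z ⟨hz, hc⟩
      obtain ⟨a, ha, b, hb, rfl⟩ := mem_C_sup.1 hz
      replace hc := mem_cyc_succ.1 hc
      obtain ⟨c, d, hd, hdb⟩ := hg _ ⟨key m a ha b hb hc, bd_mem_cyc a⟩
      obtain ⟨hdF, hdG⟩ := mem_C_inf.1 hd
      refine ⟨c, ?_⟩
      rw [show a + b - c • (x - y) = (a - c • x - d) + (b + c • y + d) by rw [smul_sub]; abel]
      refine add_mem (hF' _ _ (sub_mem (sub_mem ha (Submodule.smul_mem _ _ hx)) hdF) ?_)
        (hG' _ _ (add_mem (add_mem hb (Submodule.smul_mem _ _ hy)) hdG) ?_)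
      · refine mem_cyc_succ.2 ?_
        rw [map_sub, map_sub, map_smul, hxz, hdb, sub_self]
      · refine mem_cyc_succ.2 ?_
        rw [map_add, map_add, map_smul, hyz, hdb,
          add_add_sub_cancel, add_comm, ← map_add, hc]

lemma qi_sup {F G : Fam X} (hG : G.HT none) (hI : (F ⊓ G).HT none) : QI F (F ⊔ G) where
  le := le_C_sup_left F G
  surj n z hz := by
    have hG' : ∀ n, ∀ a ∈ G.C n, a ∈ cyc n → a ∈ (F ⊔ G).B n := fun n a ha hc =>
      B_mono (le_C_sup_right F G) n (hG.acyclic n (by simp) ⟨ha, hc⟩)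
    obtain ⟨a, ha, b, hb, rfl⟩ := mem_C_sup.1 hz.1
    cases n with
    | zero => exact ⟨a, ⟨ha, trivial⟩, by simpa using hG' 0 b hb trivial⟩
    | succ n =>
      have hc := mem_cyc_succ.1 hz.2
      obtain ⟨c, hcI, hcb⟩ := hI.acyclic n (by simp)
        ⟨mem_C_inf_of_add_eq (F.bd_mem ha) (G.bd_mem hb) (by rw [← map_add, hc]), bd_mem_cyc a⟩
      obtain ⟨hcF, hcG⟩ := mem_C_inf.1 hcI
      refine ⟨a - c, ⟨sub_mem ha hcF, ?_⟩, ?_⟩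
      · refine mem_cyc_succ.2 ?_
        rw [map_sub, hcb, sub_self]
      · rw [show a + b - (a - c) = b + c by abel]
        refine hG' _ _ (add_mem hb hcG) ?_
        refine mem_cyc_succ.2 ?_
        rw [map_add, hcb, add_comm, ← map_add, hc]
  inj n z hz hb := by
    obtain ⟨w, hw, rfl⟩ := hb
    obtain ⟨p, hp, q, hq, rfl⟩ := mem_C_sup.1 hw
    have h : bd n q ∈ F.C n := by
      have := sub_mem hz.1 (F.bd_mem hp)
      rwa [map_add, add_sub_cancel_left] at this
    obtain ⟨c, hc, hcb⟩ := hI.acyclic n (by simp) ⟨mem_C_inf.2 ⟨h, G.bd_mem hq⟩, bd_mem_cyc q⟩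
    exact ⟨p + c, add_mem hp (mem_C_inf.1 hc).1, by rw [map_add, map_add, hcb]⟩

lemma small_pair (U W : Set X) : small {U, W} = sing U ⊔ sing W := by
  change Fam.mk _ _ = Fam.mk _ _
  congr 1
  funext n
  ext s
  change (∃ V ∈ ({U, W} : Set (Set X)), _) ↔ (∀ t, s t ∈ U) ∨ ∀ t, s t ∈ W
  simp

lemma sing_inf (U W : Set X) : sing U ⊓ sing W = sing (U ∩ W) := by
  change Fam.mk _ _ = Fam.mk _ _
  congr 1
  funext n
  ext s
  exact forall_and.symm

lemma qi_union {U W : Set X} (hU : IsOpen U) (hW : IsOpen W) :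
    QI (sing U ⊔ sing W) (sing (U ∪ W)) := by
  rw [← small_pair, ← Set.sUnion_pair]
  exact qi_small (Set.insert_nonempty _ _) (by rintro _ (rfl | rfl) <;> assumption)

lemma HT.union_of_acyclic {U W : Set X} (hU : IsOpen U) (hW : IsOpen W) {o : Option ℕ}
    (h : (sing U).HT none) (h' : (sing W).HT none) (hI : (sing (U ∩ W)).HT o) :
    (sing (U ∪ W)).HT (o.map Nat.succ) :=
  (qi_union hU hW).ht (h.sup_of_acyclic h' (by rwa [sing_inf]))

lemma HT.union {U W : Set X} (hU : IsOpen U) (hW : IsOpen W) {o : Option ℕ}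
    (h : (sing U).HT o) (h' : (sing W).HT none) (hI : (sing (U ∩ W)).HT none) :
    (sing (U ∪ W)).HT o :=
  (qi_union hU hW).ht ((qi_sup h' (by rwa [sing_inf])).ht h)

lemma ht_empty : (sing (∅ : Set X)).HT (some 0) := by
  have h : ∀ n, (sing (∅ : Set X)).C (n + 1) = ⊥ := fun n => by
    rw [C, show (sing (∅ : Set X)).mem (n + 1) = ∅ from
      Set.eq_empty_iff_forall_notMem.2 fun s hs => hs (bary n), Finsupp.supported_empty]
  have hB : ∀ n, (sing (∅ : Set X)).B n = ⊥ := fun n => by rw [B, h, Submodule.map_bot]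
  constructor
  · rintro (_ | n) hn
    · exact absurd rfl hn
    · rw [h]; exact inf_le_left.trans bot_le
  · rintro m hm
    obtain rfl : 0 = m := Option.some.inj hm
    have he : IsEmpty (Spx 0) := ⟨fun t => absurd t.2.2 (by simp)⟩
    let e : C(Spx 0, X) := ⟨fun t => he.elim t, continuous_of_const fun t => he.elim t⟩
    have hu : ∀ s : C(Spx 0, X), s = e := fun s => by ext t; exact he.elim t
    refine ⟨Finsupp.single e 1, ⟨Finsupp.single_mem_supported ℚ _ fun t => he.elim t, trivial⟩,
      ?_, fun z hz => ⟨z e, ?_⟩⟩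
    · rw [hB, Submodule.mem_bot, Finsupp.single_eq_zero]; exact one_ne_zero
    · rw [hB, Submodule.mem_bot, sub_eq_zero]
      ext s
      rw [hu s]
      simp

end Fam

/-! ### Star-shaped sets -/

/-- Subsets of a normed space which are star-shaped have no homology. -/
lemma ht_of_star {W : Type} [NormedAddCommGroup W] [NormedSpace ℝ W] {T : Set W} (A : Set T) (q : W)
    (hq : ∃ a ∈ A, a.1 = q)
    (hA : ∀ p ∈ A, ∀ r : ℝ, 0 ≤ r → r < 1 → ∃ a ∈ A, a.1 = r • q + (1 - r) • p.1) :
    (Fam.sing A).HT none := by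
  let ι : C(T, W) := ⟨Subtype.val, continuous_subtype_val⟩
  have hinj : ∀ n, Function.Injective (push n ι) := fun n =>
    Finsupp.mapDomain_injective fun s s' h => by
      ext t; exact DFunLike.congr_fun h t
  have hcone : ∀ n (s : C(Spx n, T)), s ∈ (Fam.sing A).mem n → ∃ s' ∈ (Fam.sing A).mem (n + 1),
      ι.comp s' = (linCone q).cone (ι.comp s) := by
    intro n s hs
    have h := linCone_mem (A := {w | ∃ a ∈ A, a.1 = w}) (q := q) (s := ι.comp s) hq
      (by rintro _ ⟨p, hp, rfl⟩ r h0 h1; exact hA p hp r h0 h1) fun t => ⟨s t, hs t, rfl⟩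
    choose f hf hf' using h
    refine ⟨⟨f, ?_⟩, hf, ?_⟩
    · rw [continuous_induced_rng]
      exact (funext hf' : Subtype.val ∘ f = _) ▸ ContinuousMap.continuous _
    · ext1 t; exact hf' t
  have hch : ∀ n, ∀ z ∈ (Fam.sing A).C n, ∃ c ∈ (Fam.sing A).C (n + 1),
      push (n + 1) ι c = (linCone q).ch n (push n ι z) := by
    intro n z hz
    refine map_mem_of_supported (((linCone q).ch n).comp (push n ι))
      (((Fam.sing A).C (n + 1)).map (push (n + 1) ι)) (fun s hs => ?_) hz
    obtain ⟨s', hs', e⟩ := hcone n s hs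
    exact ⟨Finsupp.single s' 1, Finsupp.single_mem_supported ℚ _ hs', by simp [e]⟩
  refine ⟨fun n _ z hz => ?_, by simp⟩
  obtain ⟨c, hc, e⟩ := hch n z hz.1
  refine ⟨c, hc, hinj n ?_⟩
  rw [push_bd, e]
  cases n with
  | zero => rw [ConeOp.bd_ch_zero]
  | succ n => rw [ConeOp.bd_ch_succ, ← push_bd, mem_cyc_succ.1 hz.2, map_zero, map_zero, sub_zero]

end Sing

namespace Sing

/-! ### Characters of elementary abelian 2-groups -/

/-- The nontrivial character of `ZMod 2`. -/
noncomputable def sgn (x : ZMod 2) : ℚ := if x = 0 then 1 else -1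

lemma zmod_two_cases (x : ZMod 2) : x = 0 ∨ x = 1 := by
  revert x
  decide

lemma sgn_add (x y : ZMod 2) : sgn (x + y) = sgn x * sgn y := by
  obtain rfl | rfl := zmod_two_cases x <;> obtain rfl | rfl := zmod_two_cases y <;>
    simp [sgn, show (1 + 1 : ZMod 2) = 0 from rfl]

lemma sgn_one : sgn 1 = -1 := by simp [sgn]

lemma sum_sgn {m : Type} [Fintype m] (v : m → ZMod 2) :
    ∑ g : m → ZMod 2, sgn (v ⬝ᵥ g) = if v = 0 then (Fintype.card (m → ZMod 2) : ℚ) else 0 := by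
  split_ifs with h
  · simp [h, sgn]
  · obtain ⟨r, hr⟩ := Function.ne_iff.1 h
    have h1 : v r = 1 := (zmod_two_cases _).resolve_left hr
    have := Equiv.sum_comp (Equiv.addRight (Pi.single r (1 : ZMod 2))) fun g => sgn (v ⬝ᵥ g)
    simp only [Equiv.coe_addRight, dotProduct_add, sgn_add, dotProduct_single, h1, mul_one,
      sgn_one, mul_neg, Finset.sum_neg_distrib] at this
    linarith

lemma sum_sgn_mul_sgn {m : Type} [Fintype m] (v w : m → ZMod 2) :
    ∑ g : m → ZMod 2, sgn (v ⬝ᵥ g) * sgn (w ⬝ᵥ g) =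
      if v = w then (Fintype.card (m → ZMod 2) : ℚ) else 0 := by
  simp only [← sgn_add, ← add_dotProduct, sum_sgn]
  congr 1
  rw [← sub_eq_zero (a := v)]
  congr 2
  rw [sub_eq_add_neg]
  congr 1
  funext r
  exact (ZMod.neg_eq_self_mod_two (w r)).symm

/-! ### The homology of real toric spaces -/

section RealToric

variable {α : Type} [Fintype α] {K : ASC α} {m : Type} {lam : α → m → ZMod 2}

instance : DiscreteTopology (ZMod 2) := ⟨rfl⟩

/-- The span of the characteristic vectors of the facets through a point. -/
def stab (lam : α → m → ZMod 2) (y : K.coneRealization) : Submodule (ZMod 2) (m → ZMod 2) :=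
  Submodule.span (ZMod 2) (lam '' {a | y.1 a ≠ 0})

/-- The points whose stabilizer contains a given element. -/
def stabSet (K : ASC α) (lam : α → m → ZMod 2) (k : m → ZMod 2) : Set K.coneRealization :=
  {y | k ∈ stab lam y}

lemma continuous_coneCoord (a : α) : Continuous fun y : K.coneRealization => y.1 a :=
  (continuous_apply a).comp continuous_subtype_val

lemma isOpen_coneCoord_ne (a : α) : IsOpen {y : K.coneRealization | y.1 a ≠ 0} :=
  isOpen_ne_fun (continuous_coneCoord a) continuous_const

lemma isOpen_stabSet (k : m → ZMod 2) : IsOpen (stabSet K lam k) := by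
  rw [isOpen_iff_mem_nhds]
  intro y hy
  have h : ∀ᶠ z in nhds y, ∀ a ∈ Finset.univ.filter fun a => y.1 a ≠ 0, z.1 a ≠ 0 := by
    rw [Finset.eventually_all]
    intro a ha
    exact (isOpen_coneCoord_ne a).mem_nhds (Finset.mem_filter.1 ha).2
  filter_upwards [h] with z hz
  exact Submodule.span_mono (Set.image_mono fun a ha =>
    hz a (Finset.mem_filter.2 ⟨Finset.mem_univ a, ha⟩)) hy

/-- The inclusion of the sheet indexed by `g`. -/
def sheet (K : ASC α) (lam : α → m → ZMod 2) (g : m → ZMod 2) :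
    C(K.coneRealization, K.RealToric m lam) :=
  ⟨fun y => Quot.mk _ (y, g), continuous_quot_mk.comp (Continuous.prodMk_left g)⟩

/-- The projection to the polytope. -/
def proj (K : ASC α) (lam : α → m → ZMod 2) : C(K.RealToric m lam, K.coneRealization) :=
  ⟨Quot.lift (fun p => p.1) fun _ _ h => h.1, continuous_quot_lift _ continuous_fst⟩

lemma proj_sheet (g : m → ZMod 2) (y : K.coneRealization) : proj K lam (sheet K lam g y) = y := rfl

lemma sheet_eq_iff {g h : m → ZMod 2} {y : K.coneRealization} :
    sheet K lam g y = sheet K lam h y ↔ g - h ∈ stab lam y := by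
  refine ⟨fun e => ?_, fun e => Quot.sound ⟨rfl, e⟩⟩
  have := Quot.eqvGen_exact e
  rw [Equivalence.eqvGen_iff ⟨fun p => ⟨rfl, by simp⟩,
    fun {p q} h => ⟨h.1.symm, by rw [← neg_sub, ← h.1]; exact neg_mem h.2⟩,
    fun {p q r} h h' => ⟨h.1.trans h'.1, by
      rw [← sub_add_sub_cancel p.2 q.2]; exact add_mem h.2 (by rw [h.1]; exact h'.2)⟩⟩] at this
  exact this.2

lemma exists_sheet (x : K.RealToric m lam) : ∃ g, x = sheet K lam g (proj K lam x) := by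
  obtain ⟨y, g⟩ := x
  exact ⟨g, rfl⟩

/-- The cover by sheets. -/
def sheets (K : ASC α) (lam : α → m → ZMod 2) : Set (Set (K.RealToric m lam)) :=
  Set.range fun g => Set.range (sheet K lam g)

lemma mem_small_sheets {n : ℕ} {s : C(Spx n, K.RealToric m lam)} :
    s ∈ (Fam.small (sheets K lam)).mem n ↔ ∃ g, s = (sheet K lam g).comp ((proj K lam).comp s) := by
  constructor
  · rintro ⟨_, ⟨g, rfl⟩, h⟩
    refine ⟨g, ?_⟩
    ext1 t
    obtain ⟨y, hy⟩ := h t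
    rw [ContinuousMap.comp_apply, ContinuousMap.comp_apply, ← hy, proj_sheet]
  · rintro ⟨g, h⟩
    exact ⟨_, ⟨g, rfl⟩, fun t => by rw [h]; exact ⟨_, rfl⟩⟩

lemma sheet_comp_mem {n : ℕ} (g : m → ZMod 2) (t : C(Spx n, K.coneRealization)) :
    (sheet K lam g).comp t ∈ (Fam.small (sheets K lam)).mem n :=
  mem_small_sheets.2 ⟨g, rfl⟩

lemma mem_small_sheets_one {z : Ch 1 (K.RealToric m lam)} :
    z ∈ (Fam.small (sheets K lam)).C 1 := by
  refine Finsupp.mem_supported ℚ z |>.2 fun s _ => ?_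
  obtain ⟨g, hg⟩ := exists_sheet (s (bary 0))
  refine mem_small_sheets.2 ⟨g, ?_⟩
  ext1 t
  rwa [Subsingleton.elim t (bary 0)]

variable [Fintype m]

lemma isOpen_range_sheet (g : m → ZMod 2) : IsOpen (Set.range (sheet K lam g)) := by
  change IsOpen (Quot.mk _ ⁻¹' Set.range (sheet K lam g))
  have : Quot.mk _ ⁻¹' Set.range (sheet K lam g) =
      ⋃ h, stabSet K lam (g - h) ×ˢ ({h} : Set (m → ZMod 2)) := by
    ext ⟨y, h⟩
    simp only [Set.mem_preimage, Set.mem_iUnion, Set.mem_prod, Set.mem_singleton_iff]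
    constructor
    · rintro ⟨y', e⟩
      obtain rfl : y' = y := congrArg (proj K lam) e
      exact ⟨h, sheet_eq_iff.1 e, rfl⟩
    · rintro ⟨_, e, rfl⟩
      exact ⟨y, sheet_eq_iff.2 e⟩
  rw [this]
  exact isOpen_iUnion fun h => (isOpen_stabSet _).prod (isOpen_discrete _)

lemma qi_sheets : (Fam.small (sheets K lam)).QI (Fam.sing Set.univ) := by
  have := Fam.qi_small (c := sheets K lam) (Set.range_nonempty _)
    (by rintro _ ⟨g, rfl⟩; exact isOpen_range_sheet g)
  rwa [show ⋃₀ sheets K lam = Set.univ from Set.eq_univ_of_forall fun x => by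
    obtain ⟨g, hg⟩ := exists_sheet x
    exact ⟨_, ⟨g, rfl⟩, hg ▸ ⟨_, rfl⟩⟩] at this

/-- The cover of the union of the facets on which the row `ω` is odd. -/
def oddCover (K : ASC α) (lam : α → m → ZMod 2) (ω : m → ZMod 2) : Set (Set K.coneRealization) :=
  insert ∅ (stabSet K lam '' {k | ω ⬝ᵥ k = 1})

/-- The union of the facets on which the row `ω` is odd, as an open subset of the cone. -/
def oddSet (K : ASC α) (lam : α → m → ZMod 2) (ω : m → ZMod 2) : Set K.coneRealization :=
  {y | ∃ a, y.1 a ≠ 0 ∧ ω ⬝ᵥ lam a = 1}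

lemma sUnion_oddCover (ω : m → ZMod 2) : ⋃₀ oddCover K lam ω = oddSet K lam ω := by
  ext y
  rw [oddCover, Set.sUnion_insert, Set.empty_union, Set.sUnion_image]
  simp only [Set.mem_iUnion]
  constructor
  · rintro ⟨k, hk, hy⟩
    by_contra hn
    have h0 : ∀ v ∈ stab lam y, ω ⬝ᵥ v = 0 := by
      intro v hv
      refine Submodule.span_induction ?_ (dotProduct_zero ω) (fun u v _ _ hu hv => ?_)
        (fun c u _ hu => ?_) hv
      · rintro _ ⟨a, ha, rfl⟩
        exact (zmod_two_cases _).resolve_right fun h => hn ⟨a, ha, h⟩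
      · rw [dotProduct_add, hu, hv, add_zero]
      · rw [dotProduct_smul, hu, smul_zero]
    exact zero_ne_one ((h0 k hy).symm.trans hk)
  · rintro ⟨a, ha, h⟩
    exact ⟨lam a, h, Submodule.subset_span ⟨a, ha, rfl⟩⟩

/-- The simplices contained in a single odd piece. -/
abbrev oddFam (K : ASC α) (lam : α → m → ZMod 2) (ω : m → ZMod 2) : Fam K.coneRealization :=
  Fam.small (oddCover K lam ω)

lemma qi_oddFam (ω : m → ZMod 2) : (oddFam K lam ω).QI (Fam.sing (oddSet K lam ω)) := by
  rw [← sUnion_oddCover]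
  refine Fam.qi_small (Set.insert_nonempty _ _) ?_
  rintro _ (rfl | ⟨k, -, rfl⟩)
  exacts [isOpen_empty, isOpen_stabSet k]

/-- The projection to the summand indexed by `ω` and its section. -/
noncomputable def isoEmb (K : ASC α) (lam : α → m → ZMod 2) (ω : m → ZMod 2) (n : ℕ) :
    Ch n K.coneRealization →ₗ[ℚ] Ch n (K.RealToric m lam) :=
  (Fintype.card (m → ZMod 2) : ℚ)⁻¹ • ∑ g, sgn (ω ⬝ᵥ g) • push n (sheet K lam g)

lemma isoEmb_apply (ω : m → ZMod 2) {n : ℕ} (z : Ch n K.coneRealization) :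
    isoEmb K lam ω n z = (Fintype.card (m → ZMod 2) : ℚ)⁻¹ •
      ∑ g, sgn (ω ⬝ᵥ g) • push n (sheet K lam g) z := by
  simp [isoEmb]

lemma bd_isoEmb (ω : m → ZMod 2) {n : ℕ} (z : Ch (n + 1) K.coneRealization) :
    bd n (isoEmb K lam ω (n + 1) z) = isoEmb K lam ω n (bd n z) := by
  simp [isoEmb_apply, push_bd]

lemma isoEmb_mem (ω : m → ZMod 2) {n : ℕ} (z : Ch n K.coneRealization) :
    isoEmb K lam ω n z ∈ (Fam.small (sheets K lam)).C n := by
  rw [isoEmb_apply]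
  refine Submodule.smul_mem _ _ (Submodule.sum_mem _ fun g _ => Submodule.smul_mem _ _ ?_)
  refine map_mem_of_supported (push n (sheet K lam g)) _ (S := Set.univ) (fun s _ => ?_) (by simp)
  rw [push_single]
  exact Finsupp.single_mem_supported ℚ _ (sheet_comp_mem g s)

lemma isoEmb_eq_zero (ω : m → ZMod 2) {n : ℕ} {z : Ch (n + 1) K.coneRealization}
    (hz : z ∈ (oddFam K lam ω).C (n + 1)) : isoEmb K lam ω (n + 1) z = 0 := by
  refine (Submodule.mem_bot ℚ).1 (map_mem_of_supported _ ⊥ (fun s hs => ?_) hz)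
  obtain ⟨_, rfl | ⟨k, hk, rfl⟩, h⟩ := hs
  · exact absurd (h (bary n)) (Set.notMem_empty _)
  rw [Submodule.mem_bot, isoEmb_apply]
  have e : ∀ g, (sheet K lam (g + k)).comp s = (sheet K lam g).comp s := fun g => by
    ext1 t
    refine sheet_eq_iff.2 ?_
    rw [add_sub_cancel_left]
    exact h t
  have := Equiv.sum_comp (Equiv.addRight k) fun g => sgn (ω ⬝ᵥ g) •
    push (n + 1) (sheet K lam g) (Finsupp.single s 1)
  simp only [Equiv.coe_addRight, push_single, e, dotProduct_add, sgn_add,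
    show ω ⬝ᵥ k = 1 from hk, sgn_one, mul_neg, mul_one, neg_smul, Finset.sum_neg_distrib] at this
  simp only [push_single]
  rw [neg_eq_self.1 this, smul_zero]

/-- A sheet containing the given simplex, if there is one. -/
noncomputable def sheetOf {n : ℕ} (s : C(Spx n, K.RealToric m lam)) : m → ZMod 2 :=
  if h : ∃ g, s = (sheet K lam g).comp ((proj K lam).comp s) then h.choose else 0

/-- The projection of chains to the summand indexed by `ω`. -/
noncomputable def isoProj (K : ASC α) (lam : α → m → ZMod 2) (ω : m → ZMod 2) (n : ℕ) :
    Ch n (K.RealToric m lam) →ₗ[ℚ] Ch n K.coneRealization :=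
  Finsupp.linearCombination ℚ fun s =>
    Finsupp.single ((proj K lam).comp s) (sgn (ω ⬝ᵥ sheetOf s))

lemma isoProj_single (ω : m → ZMod 2) {n : ℕ} (s : C(Spx n, K.RealToric m lam)) :
    isoProj K lam ω n (Finsupp.single s 1) =
      Finsupp.single ((proj K lam).comp s) (sgn (ω ⬝ᵥ sheetOf s)) := by
  simp [isoProj]

lemma isoProj_sheet (ω g : m → ZMod 2) {n : ℕ} (t : C(Spx n, K.coneRealization)) :
    isoProj K lam ω n (Finsupp.single ((sheet K lam g).comp t) 1) -
      Finsupp.single t (sgn (ω ⬝ᵥ g)) ∈ (oddFam K lam ω).C n := by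
  set s := (sheet K lam g).comp t with hs
  have hp : (proj K lam).comp s = t := rfl
  have hex : ∃ g, s = (sheet K lam g).comp ((proj K lam).comp s) := ⟨g, rfl⟩
  have hsp : s = (sheet K lam (sheetOf s)).comp ((proj K lam).comp s) := by
    conv_rhs => rw [sheetOf, dif_pos hex]
    exact hex.choose_spec
  rw [isoProj_single, hp]
  rw [hp] at hsp
  by_cases h : ω ⬝ᵥ (sheetOf s - g) = 1
  · rw [← Finsupp.single_sub]
    refine Finsupp.single_mem_supported ℚ _ ⟨_, Or.inr ⟨_, h, rfl⟩, fun x => ?_⟩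
    exact sheet_eq_iff.1 (DFunLike.congr_fun (hsp.symm.trans hs) x)
  · have h0 := (zmod_two_cases _).resolve_right h
    rw [dotProduct_sub, sub_eq_zero] at h0
    rw [h0, sub_self]
    exact zero_mem _

lemma isoProj_bd (ω : m → ZMod 2) {n : ℕ} {z : Ch (n + 1) (K.RealToric m lam)}
    (hz : z ∈ (Fam.small (sheets K lam)).C (n + 1)) :
    isoProj K lam ω n (bd n z) - bd n (isoProj K lam ω (n + 1) z) ∈ (oddFam K lam ω).C n := by
  refine map_mem_of_supported ((isoProj K lam ω n).comp (bd n) -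
    (bd n).comp (isoProj K lam ω (n + 1))) _ (fun s hs => ?_) hz
  obtain ⟨g, hg⟩ := mem_small_sheets.1 hs
  generalize (proj K lam).comp s = t at hg
  subst hg
  rw [LinearMap.sub_apply, LinearMap.comp_apply, LinearMap.comp_apply]
  rw [← sub_sub_sub_cancel_right _ _ (bd n (Finsupp.single t (sgn (ω ⬝ᵥ g))))]
  refine sub_mem ?_ ?_
  · rw [bd_single, bd_single, map_sum, ← Finset.sum_sub_distrib]
    refine Submodule.sum_mem _ fun i _ => ?_
    rw [map_smul, ← smul_sub]
    exact Submodule.smul_mem _ _ (isoProj_sheet ω g (t.comp (face i)))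
  · rw [← map_sub]
    exact (oddFam K lam ω).bd_mem (isoProj_sheet ω g t)

lemma isoProj_isoEmb (ω ω' : m → ZMod 2) {n : ℕ} (z : Ch n K.coneRealization) :
    isoProj K lam ω n (isoEmb K lam ω' n z) - (if ω' = ω then z else 0) ∈
      (oddFam K lam ω).C n := by
  have hc : (Fintype.card (m → ZMod 2) : ℚ) ≠ 0 := Nat.cast_ne_zero.2 Fintype.card_ne_zero
  let L : Ch n K.coneRealization →ₗ[ℚ] Ch n K.coneRealization :=
    (isoProj K lam ω n).comp (isoEmb K lam ω' n) - (if ω' = ω then LinearMap.id else 0)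
  have hL : ∀ z, L z = isoProj K lam ω n (isoEmb K lam ω' n z) - (if ω' = ω then z else 0) := by
    intro z
    simp only [L]
    split_ifs <;> simp
  rw [← hL]
  refine map_mem_of_supported L _ (S := Set.univ) (fun t _ => ?_) (by simp)
  rw [hL]
  have e : (if ω' = ω then (Finsupp.single t 1 : Ch n K.coneRealization) else 0) =
      (Fintype.card (m → ZMod 2) : ℚ)⁻¹ •
        ∑ g, sgn (ω' ⬝ᵥ g) • Finsupp.single t (sgn (ω ⬝ᵥ g)) := by
    simp only [Finsupp.smul_single, smul_eq_mul, ← Finsupp.single_finsetSum, sum_sgn_mul_sgn]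
    split_ifs <;> simp
  rw [e, isoEmb_apply, map_smul, map_sum, ← smul_sub, ← Finset.sum_sub_distrib]
  refine Submodule.smul_mem _ _ (Submodule.sum_mem _ fun g _ => ?_)
  rw [map_smul, ← smul_sub, push_single]
  exact Submodule.smul_mem _ _ (isoProj_sheet ω g t)

lemma sum_isoEmb_isoProj {n : ℕ} {z : Ch (n + 1) (K.RealToric m lam)}
    (hz : z ∈ (Fam.small (sheets K lam)).C (n + 1)) :
    ∑ ω, isoEmb K lam ω (n + 1) (isoProj K lam ω (n + 1) z) = z := by
  have hc : (Fintype.card (m → ZMod 2) : ℚ) ≠ 0 := Nat.cast_ne_zero.2 Fintype.card_ne_zero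
  rw [← sub_eq_zero]
  have := map_mem_of_supported (∑ ω, (isoEmb K lam ω (n + 1)).comp (isoProj K lam ω (n + 1)) -
    LinearMap.id) ⊥ (fun s hs => ?_) hz
  · simpa using this
  obtain ⟨g, hg⟩ := mem_small_sheets.1 hs
  generalize (proj K lam).comp s = t at hg
  subst hg
  have e : ∀ ω, isoEmb K lam ω (n + 1)
      (isoProj K lam ω (n + 1) (Finsupp.single ((sheet K lam g).comp t) 1)) =
      (Fintype.card (m → ZMod 2) : ℚ)⁻¹ • ∑ h, (sgn (g ⬝ᵥ ω) * sgn (h ⬝ᵥ ω)) •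
        Finsupp.single ((sheet K lam h).comp t) 1 := by
    intro ω
    have := isoEmb_eq_zero ω (isoProj_sheet (lam := lam) ω g t)
    rw [map_sub, sub_eq_zero] at this
    rw [this, isoEmb_apply]
    congr 1
    refine Finset.sum_congr rfl fun h _ => ?_
    rw [push_single, Finsupp.smul_single, Finsupp.smul_single, smul_eq_mul, smul_eq_mul, mul_one,
      mul_comm, dotProduct_comm ω g, dotProduct_comm ω h]
  rw [Submodule.mem_bot, LinearMap.sub_apply, LinearMap.sum_apply, sub_eq_zero]
  simp only [LinearMap.comp_apply, e]
  rw [← Finset.smul_sum, Finset.sum_comm]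
  simp only [← Finset.sum_smul, sum_sgn_mul_sgn]
  simp

/-- The cycles of the chain complex without augmentation. -/
noncomputable def ucyc {X : Type} [TopologicalSpace X] : ∀ n : ℕ, Submodule ℚ (Ch (n + 1) X)
  | 0 => ⊤
  | n + 1 => LinearMap.ker (bd (n + 1))

theorem exists_basis (hK : (Fam.sing (Set.univ : Set K.coneRealization)).HT none)
    (typ : (m → ZMod 2) → Option ℕ) (ht : ∀ ω, (Fam.sing (oddSet K lam ω)).HT (typ ω)) (n : ℕ) :
    ∃ ζ : {ω // typ ω = some n} → Ch (n + 1) (K.RealToric m lam),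
      (∀ i, ζ i ∈ ucyc n) ∧
      (∀ c : {ω // typ ω = some n} → ℚ, ∑ i, c i • ζ i ∈ LinearMap.range (bd (n + 1)) → c = 0) ∧
      ∀ z ∈ ucyc n, ∃ c : {ω // typ ω = some n} → ℚ,
        z - ∑ i, c i • ζ i ∈ LinearMap.range (bd (n + 1)) := by
  have hY : ∀ n, ∀ z : Ch n K.coneRealization, z ∈ cyc n → ∃ x, bd n x = z := by
    intro n z hz
    obtain ⟨x, -, hx⟩ := hK.acyclic n (by simp)
      ⟨(Finsupp.mem_supported ℚ z).2 fun s _ t => trivial, hz⟩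
    exact ⟨x, hx⟩
  have ho : ∀ ω, (oddFam K lam ω).HT (typ ω) := fun ω => (qi_oddFam ω).ht' (ht ω)
  have hgen := fun i : {ω // typ ω = some n} => (ho i.1).generated n i.2
  choose w hw hwb hwg using hgen
  choose x hx using fun i => hY n (w i) (hw i).2
  refine ⟨fun i => isoEmb K lam i.1 (n + 1) (x i), fun i => ?_, fun c hc => ?_, fun z hz => ?_⟩
  · cases n with
    | zero => trivial
    | succ n =>
      rw [ucyc, LinearMap.mem_ker, bd_isoEmb, hx, isoEmb_eq_zero _ (hw i).1]
  · obtain ⟨y, hy⟩ := hc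
    obtain ⟨y, hys, hy⟩ : ∑ i, c i • isoEmb K lam i.1 (n + 1) (x i) ∈
        (Fam.small (sheets K lam)).B (n + 1) :=
      qi_sheets.inj (n + 1) _ ⟨Submodule.sum_mem _ fun i _ =>
        Submodule.smul_mem _ _ (isoEmb_mem _ _), hy ▸ bd_mem_cyc y⟩
        ⟨y, (Finsupp.mem_supported ℚ y).2 fun s _ t => trivial, hy⟩
    funext i
    by_contra hi
    refine hwb i ?_
    have h1 : isoProj K lam i.1 (n + 1) (bd (n + 1) y) - c i • x i ∈
        (oddFam K lam i.1).C (n + 1) := by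
      rw [hy, map_sum]
      have e : c i • x i = ∑ j, c j • (if j.1 = i.1 then x j else 0) := by
        rw [Finset.sum_eq_single i] <;> simp +contextual [Subtype.ext_iff]
      rw [e, ← Finset.sum_sub_distrib]
      refine Submodule.sum_mem _ fun j _ => ?_
      rw [map_smul, ← smul_sub]
      exact Submodule.smul_mem _ _ (isoProj_isoEmb _ _ _)
    have h2 := sub_mem h1 (isoProj_bd i.1 hys)
    rw [sub_sub_sub_cancel_left] at h2
    have h3 : c i • w i ∈ (oddFam K lam i.1).B n := by
      refine ⟨_, neg_mem h2, ?_⟩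
      rw [map_neg, map_sub, bd_bd, map_smul, hx, zero_sub, neg_neg]
    have := Submodule.smul_mem _ (c i)⁻¹ h3
    rwa [smul_smul, inv_mul_cancel₀ hi, one_smul] at this
  · have hz' : ∃ z' ∈ (Fam.small (sheets K lam)).C (n + 1), z' ∈ ucyc n ∧
        z - z' ∈ LinearMap.range (bd (n + 1)) := by
      cases n with
      | zero => exact ⟨z, mem_small_sheets_one, trivial, by simp⟩
      | succ n =>
        obtain ⟨z', hz', y, -, hy⟩ := qi_sheets.surj (n + 2) z
          ⟨(Finsupp.mem_supported ℚ z).2 fun s _ t => trivial, hz⟩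
        exact ⟨z', hz'.1, hz'.2, y, hy⟩
    obtain ⟨z', hzs, hzc, hzz⟩ := hz'
    have hv : ∀ ω, bd n (isoProj K lam ω (n + 1) z') ∈ (oddFam K lam ω).C n := by
      intro ω
      cases n with
      | zero =>
        refine (Finsupp.mem_supported ℚ _).2 fun s _ => ⟨∅, Or.inl rfl, fun t => ?_⟩
        exact absurd t.2.2 (by simp)
      | succ n =>
        have := isoProj_bd ω hzs
        rw [LinearMap.mem_ker.1 hzc, map_zero, zero_sub] at this
        exact neg_mem_iff.1 this
    have hc : ∀ ω, ∃ c : ℚ, isoEmb K lam ω (n + 1) (isoProj K lam ω (n + 1) z') -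
        (if h : typ ω = some n then c • isoEmb K lam ω (n + 1) (x ⟨ω, h⟩) else 0) ∈
          LinearMap.range (bd (n + 1)) := by
      intro ω
      have key : ∀ y d, d ∈ (oddFam K lam ω).C (n + 1) →
          bd n d = bd n (isoProj K lam ω (n + 1) z') - bd n y →
          isoEmb K lam ω (n + 1) (isoProj K lam ω (n + 1) z') - isoEmb K lam ω (n + 1) y ∈
            LinearMap.range (bd (n + 1)) := by
        intro y d hd hdb
        obtain ⟨e, he⟩ := hY (n + 1) (isoProj K lam ω (n + 1) z' - y - d)
          (mem_cyc_succ.2 (by rw [map_sub, map_sub, hdb, sub_self]))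
        exact ⟨isoEmb K lam ω _ e, by
          rw [bd_isoEmb, he, map_sub, map_sub, isoEmb_eq_zero ω hd, sub_zero]⟩
      by_cases h : typ ω = some n
      · obtain ⟨c, d, hd, hdb⟩ := hwg ⟨ω, h⟩ _ ⟨hv ω, bd_mem_cyc _⟩
        refine ⟨c, ?_⟩
        rw [dif_pos h, ← map_smul]
        exact key _ d hd (by rw [hdb, map_smul, hx])
      · obtain ⟨d, hd, hdb⟩ := (ho ω).acyclic n h ⟨hv ω, bd_mem_cyc _⟩
        refine ⟨0, ?_⟩
        rw [dif_neg h, ← map_zero (isoEmb K lam ω (n + 1))]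
        exact key 0 d hd (by rw [hdb, map_zero, sub_zero])
    choose c hc using hc
    refine ⟨fun i => c i.1, ?_⟩
    have e : ∑ i : {ω // typ ω = some n}, c i.1 • isoEmb K lam i.1 (n + 1) (x i) =
        ∑ ω, if h : typ ω = some n then c ω • isoEmb K lam ω (n + 1) (x ⟨ω, h⟩) else 0 := by
      rw [← Finset.sum_filter_of_ne (p := fun ω => typ ω = some n)
        (fun ω _ h => by by_contra hn; exact h (dif_neg hn)),
        ← Finset.sum_subtype_eq_sum_filter, Finset.subtype_univ]
      exact Finset.sum_congr rfl fun i _ => by rw [dif_pos i.2]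
    rw [e, ← sub_add_sub_cancel z z']
    refine add_mem hzz ?_
    conv in z' - _ => rw [← sum_isoEmb_isoProj hzs]
    rw [← Finset.sum_sub_distrib]
    exact Submodule.sum_mem _ fun ω _ => hc ω

end RealToric

end Sing

namespace Sing
open CategoryTheory Simplicial

lemma finrank_homology (S : ShortComplex (ModuleCat ℚ)) {I : Type} [Fintype I] (ζ : I → S.X₂)
    (hζ : ∀ i, S.g (ζ i) = 0)
    (hi : ∀ c : I → ℚ, ∑ i, c i • ζ i ∈ LinearMap.range S.f.hom → c = 0)
    (hs : ∀ z, S.g z = 0 → ∃ c : I → ℚ, z - ∑ i, c i • ζ i ∈ LinearMap.range S.f.hom) :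
    Module.finrank ℚ S.homology = Fintype.card I := by
  let φ : (I → ℚ) →ₗ[ℚ] LinearMap.ker S.g.hom :=
    Fintype.linearCombination ℚ fun i => ⟨ζ i, hζ i⟩
  have hφ : ∀ c, (φ c : S.X₂) = ∑ i, c i • ζ i := by
    intro c
    simp [φ, Fintype.linearCombination_apply]
  have hr : ∀ z : LinearMap.ker S.g.hom,
      z ∈ LinearMap.range S.moduleCatToCycles ↔ (z : S.X₂) ∈ LinearMap.range S.f.hom := by
    intro z
    constructor
    · rintro ⟨y, rfl⟩
      exact ⟨y, rfl⟩
    · rintro ⟨y, hy⟩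
      exact ⟨y, Subtype.ext hy⟩
  let ψ := (LinearMap.range S.moduleCatToCycles).mkQ ∘ₗ φ
  have hψ : Function.Bijective ψ := by
    refine ⟨(injective_iff_map_eq_zero ψ).2 fun c hc => hi c ?_, fun q => ?_⟩
    · rw [← hφ, ← hr]
      exact (Submodule.Quotient.mk_eq_zero _).1 hc
    · obtain ⟨z, rfl⟩ := Submodule.Quotient.mk_surjective _ q
      obtain ⟨c, hc⟩ := hs z z.2
      refine ⟨c, Eq.symm ((Submodule.Quotient.eq _).2 ((hr _).2 ?_))⟩
      rwa [Submodule.coe_sub, hφ]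
  rw [← Module.finrank_fintype_fun_eq_card ℚ (η := I), (LinearEquiv.ofBijective ψ hψ).finrank_eq]
  exact S.moduleCatHomologyIso.toLinearEquiv.finrank_eq

section
variable {X : Type} [TopologicalSpace X]

noncomputable def chEquiv (X : Type) [TopologicalSpace X] (n : ℕ) :
    (singularChains X).X n ≃ₗ[ℚ] Ch (n + 1) X :=
  Finsupp.domLCongr (TopCat.toSSetObjEquiv (TopCat.of X) (Opposite.op ⦋n⦌))

lemma chEquiv_single (n : ℕ) (s : (TopCat.toSSet.obj (TopCat.of X)) _⦋n⦌) (a : ℚ) :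
    chEquiv X n (Finsupp.single s a) =
      Finsupp.single ((TopCat.of X).toSSetObjEquiv (Opposite.op ⦋n⦌) s) a :=
  Finsupp.domLCongr_single _ _ _

lemma sum_smul_lmapDomain_single {S T : Type} {k : ℕ} (c : Fin k → ℤ) (f : Fin k → S → T) (s : S)
    (a : ℚ) : (∑ i, c i • Finsupp.lmapDomain ℚ ℚ (f i)) (Finsupp.single s a) =
      ∑ i, c i • Finsupp.single (f i s) a := by
  rw [LinearMap.sum_apply]
  refine Finset.sum_congr rfl fun i _ => ?_
  rw [LinearMap.smul_apply, Finsupp.lmapDomain_apply, Finsupp.mapDomain_single]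

lemma d_single (n : ℕ) (s : (TopCat.toSSet.obj (TopCat.of X)) _⦋n + 1⦌) (a : ℚ) :
    ((singularChains X).d (n + 1) n).hom (Finsupp.single s a) =
      ∑ i : Fin (n + 2), (-1 : ℤ) ^ (i : ℕ) •
        (Finsupp.single ((TopCat.toSSet.obj (TopCat.of X)).δ i s) a :
          (TopCat.toSSet.obj (TopCat.of X)) _⦋n⦌ →₀ ℚ) := by
  have h : ((singularChains X).d (n + 1) n).hom = ∑ i : Fin (n + 2), (-1 : ℤ) ^ (i : ℕ) •
      Finsupp.lmapDomain ℚ ℚ ((TopCat.toSSet.obj (TopCat.of X)).δ i) :=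
    (congrArg ModuleCat.Hom.hom
      (AlgebraicTopology.AlternatingFaceMapComplex.obj_d_eq _ _)).trans (ModuleCat.hom_sum _ _)
  exact (LinearMap.congr_fun h _).trans (sum_smul_lmapDomain_single _ _ _ _)

lemma chEquiv_d (n : ℕ) (z : (singularChains X).X (n + 1)) :
    chEquiv X n (((singularChains X).d (n + 1) n).hom z) = bd (n + 1) (chEquiv X (n + 1) z) := by
  have h : (chEquiv X n).toLinearMap ∘ₗ ((singularChains X).d (n + 1) n).hom =
      bd (n + 1) ∘ₗ (chEquiv X (n + 1)).toLinearMap := by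
    refine Finsupp.lhom_ext' fun s => LinearMap.ext_ring ?_
    change chEquiv X n (((singularChains X).d (n + 1) n).hom (Finsupp.single s 1)) =
      bd (n + 1) (chEquiv X (n + 1) (Finsupp.single s 1))
    rw [chEquiv_single, bd_single, d_single]
    refine (map_sum (chEquiv X n) _ _).trans (Finset.sum_congr rfl fun i _ => ?_)
    refine (map_zsmul (chEquiv X n) _ _).trans ?_
    rw [chEquiv_single, ← Int.cast_smul_eq_zsmul ℚ]
    push_cast
    rfl
  exact LinearMap.congr_fun h z

lemma ucyc_iff (n : ℕ) (z : (singularChains X).X n) :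
    chEquiv X n z ∈ ucyc n ↔ (singularChains X).d n ((ComplexShape.down ℕ).next n) z = 0 := by
  cases n with
  | zero =>
    refine ⟨fun _ => ?_, fun _ => trivial⟩
    rw [(singularChains X).shape]
    · rfl
    · simp
  | succ n =>
    rw [ChainComplex.next_nat_succ, ucyc, LinearMap.mem_ker, ← chEquiv_d,
      map_eq_zero_iff _ (chEquiv X n).injective]

lemma range_iff (n : ℕ) (z : (singularChains X).X n) :
    chEquiv X n z ∈ LinearMap.range (bd (n + 1)) ↔
      z ∈ LinearMap.range ((singularChains X).d (n + 1) n).hom := by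
  constructor
  · rintro ⟨y, hy⟩
    refine ⟨(chEquiv X (n + 1)).symm y, (chEquiv X n).injective ?_⟩
    rw [← hy]
    refine (chEquiv_d n _).trans ?_
    rw [LinearEquiv.apply_symm_apply]
  · rintro ⟨y, rfl⟩
    exact ⟨_, (chEquiv_d n y).symm⟩

theorem betti_eq_card {I : Type} [Fintype I] {n : ℕ} (ζ : I → Ch (n + 1) X) (hζ : ∀ i, ζ i ∈ ucyc n)
    (hi : ∀ c : I → ℚ, ∑ i, c i • ζ i ∈ LinearMap.range (bd (n + 1)) → c = 0)
    (hs : ∀ z ∈ ucyc n, ∃ c : I → ℚ, z - ∑ i, c i • ζ i ∈ LinearMap.range (bd (n + 1))) :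
    betti X n = Fintype.card I := by
  rw [betti, ((singularChains X).homologyIsoSc' (n + 1) n _ (by simp) rfl).toLinearEquiv.finrank_eq]
  let e := chEquiv X n
  have h : ∀ c : I → ℚ, e (∑ i, c i • e.symm (ζ i)) = ∑ i, c i • ζ i := fun c => by simp [map_sum]
  refine finrank_homology _ (fun i => e.symm (ζ i)) (fun i => (ucyc_iff n _).1 ?_)
    (fun c hc => hi c ?_) fun z hz => ?_
  · rw [LinearEquiv.apply_symm_apply]
    exact hζ i
  · rw [← h]
    exact (range_iff n _).2 hc
  · obtain ⟨c, hc⟩ := hs _ ((ucyc_iff n z).2 hz)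
    rw [← h c] at hc
    exact ⟨c, (range_iff n _).1 ((map_sub e z _).symm ▸ hc)⟩

end

end Sing

namespace Sing

section Flag

variable {α : Type} [Fintype α] {K : ASC α}

/-- The open star of a set of vertices in the cone on `K`. -/
def openStar (K : ASC α) (T : Set α) : Set K.coneRealization := {y | ∀ a ∈ T, y.1 a ≠ 0}

lemma isOpen_openStar {T : Set α} (hT : T.Finite) : IsOpen (openStar K T) := by
  have : openStar K T = ⋂ a ∈ T, {y : K.coneRealization | y.1 a ≠ 0} := by
    ext y
    simp [openStar]
  rw [this]
  exact hT.isOpen_biInter fun a _ => isOpen_coneCoord_ne a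

lemma ht_openStar {T : Finset α} (hT : T ∈ K.faces) : (Fam.sing (openStar K T)).HT none := by
  have hq : ∀ a, (if a ∈ T then (T.card : ℝ)⁻¹ else 0) ≠ 0 ↔ a ∈ T := by
    intro a
    by_cases h : a ∈ T
    · simpa [h] using Finset.ne_empty_of_mem h
    · simp [h]
  have hq0 : ∀ a, 0 ≤ if a ∈ T then (T.card : ℝ)⁻¹ else 0 := by
    intro a
    split_ifs <;> positivity
  have hq1 : ∑ a, (if a ∈ T then (T.card : ℝ)⁻¹ else 0) ≤ 1 := by
    simp [mul_inv_le_one]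
  refine ht_of_star (W := α → ℝ) (openStar K T) (fun a => if a ∈ T then (T.card : ℝ)⁻¹ else 0)
    ⟨⟨_, hq0, hq1, ?_⟩, fun a ha => (hq a).2 ha, rfl⟩ ?_
  · simpa [hq] using hT
  · rintro ⟨p, hp0, hp1, hpK⟩ hp r hr0 hr1
    have hr : 0 < 1 - r := sub_pos.2 hr1
    have hne : ∀ a, r * (if a ∈ T then (T.card : ℝ)⁻¹ else 0) + (1 - r) * p a ≠ 0 ↔ p a ≠ 0 := by
      intro a
      refine ⟨fun h hpa => h ?_, fun h => ne_of_gt ?_⟩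
      · have : a ∉ T := fun ha => hp a ha hpa
        simp [hpa, this]
      · exact add_pos_of_nonneg_of_pos (mul_nonneg hr0 (hq0 a))
          (mul_pos hr (lt_of_le_of_ne (hp0 a) h.symm))
    refine ⟨⟨_, fun a => add_nonneg (mul_nonneg hr0 (hq0 a)) (mul_nonneg hr.le (hp0 a)), ?_, ?_⟩,
      fun a ha => (hne a).2 (hp a ha), rfl⟩
    · change ∑ a, (r * (if a ∈ T then (T.card : ℝ)⁻¹ else 0) + (1 - r) * p a) ≤ 1
      rw [Finset.sum_add_distrib, ← Finset.mul_sum, ← Finset.mul_sum]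
      nlinarith
    · change Finset.univ.filter (fun a =>
        r * (if a ∈ T then (T.card : ℝ)⁻¹ else 0) + (1 - r) * p a ≠ 0) ∈ K.faces
      simpa only [hne] using hpK

variable {ι : Type} (c : ι → ι → Bool)

/-- `b` is compatible with all elements of the list `s`. -/
def compat (b : ι) (s : List ι) : Bool := s.all (c b)

/-- The homology type of the part of the open star of the clique `s` where some coordinate from a
list is nonzero, computed by removing the entries of this list one at a time. -/
def flagType (s : List ι) : List ι → Option (Option ℕ)
  | [] => some (some 0)
  | b :: S =>
    bif compat c b s then
      bif S.any fun b' => compat c b' s then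
        match flagType (b :: s) S, flagType s S with
        | some none, some o => some o
        | some o, some none => some (o.map Nat.succ)
        | _, _ => none
      else some none
    else flagType s S

variable {c} {τ : ι → α}

/-- The clique complex of `c`, where only the vertices in the image of `τ` are used. -/
structure IsFlag (K : ASC α) (c : ι → ι → Bool) (τ : ι → α) : Prop where
  compatible : ∀ s ∈ K.faces, ∀ i j, τ i ∈ s → τ j ∈ s → c i j
  face : ∀ σ : List ι, (∀ i ∈ σ, ∀ j ∈ σ, c i j) → ∃ s ∈ K.faces, (s : Set α) = τ '' {i | i ∈ σ}

/-- The part of the open star of `s` where some coordinate from `S` is nonzero. -/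
def starPart (K : ASC α) (τ : ι → α) (s S : List ι) : Set K.coneRealization :=
  {y | (∀ i ∈ s, y.1 (τ i) ≠ 0) ∧ ∃ i ∈ S, y.1 (τ i) ≠ 0}

lemma starPart_nil (s : List ι) : starPart K τ s [] = ∅ := by
  ext y
  simp [starPart]

lemma starPart_cons (s : List ι) (b : ι) (S : List ι) :
    starPart K τ s (b :: S) = starPart K τ s S ∪ openStar K (τ '' {i | i ∈ b :: s}) := by
  ext y
  simp only [starPart, openStar, Set.mem_union, Set.mem_ofPred_eq, List.mem_cons,
    Set.forall_mem_image]
  constructor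
  · rintro ⟨h, i, rfl | hi, hy⟩
    · exact Or.inr (by rintro j (rfl | hj); exacts [hy, h j hj])
    · exact Or.inl ⟨h, i, hi, hy⟩
  · rintro (⟨h, i, hi, hy⟩ | h)
    · exact ⟨h, i, Or.inr hi, hy⟩
    · exact ⟨fun i hi => h (Or.inr hi), b, Or.inl rfl, h (Or.inl rfl)⟩

lemma starPart_inter (s : List ι) (b : ι) (S : List ι) :
    starPart K τ s S ∩ openStar K (τ '' {i | i ∈ b :: s}) = starPart K τ (b :: s) S := by
  ext y
  simp only [starPart, openStar, Set.mem_inter_iff, Set.mem_ofPred_eq, List.mem_cons,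
    Set.forall_mem_image]
  exact ⟨fun h => ⟨fun i hi => h.2 hi, h.1.2⟩,
    fun h => ⟨⟨fun i hi => h.1 (Or.inr hi), h.2⟩, fun i hi => h.1 hi⟩⟩

lemma isOpen_starPart (s S : List ι) : IsOpen (starPart K τ s S) := by
  induction S with
  | nil => rw [starPart_nil]; exact isOpen_empty
  | cons b S ih =>
    rw [starPart_cons]
    exact ih.union (isOpen_openStar (((b :: s).finite_toSet).image τ))

lemma compat_of_mem (h : IsFlag K c τ) {y : K.coneRealization} {s : List ι}
    (hs : ∀ i ∈ s, y.1 (τ i) ≠ 0) {b : ι} (hb : y.1 (τ b) ≠ 0) : compat c b s = true :=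
  List.all_eq_true.2 fun i hi => h.compatible _ y.2.2.2 b i (by simpa using hb)
    (by simpa using hs i hi)

lemma ht_starPart (h : IsFlag K c τ) (hr : ∀ i, c i i) (hc : ∀ i j, c i j = c j i) (S : List ι) :
    ∀ (s : List ι) (o : Option ℕ), (∀ i ∈ s, ∀ j ∈ s, c i j) → flagType c s S = some o →
      (Fam.sing (starPart K τ s S)).HT o := by
  induction S with
  | nil =>
    rintro s o - ho
    obtain rfl : some 0 = o := Option.some_injective _ ho
    rw [starPart_nil]
    exact Fam.ht_empty
  | cons b S ih =>
    intro s o hs ho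
    rw [flagType] at ho
    by_cases hb : compat c b s
    swap
    · rw [Bool.eq_false_of_not_eq_true hb, cond_false] at ho
      rw [starPart_cons]
      have : openStar K (τ '' {i | i ∈ b :: s}) = ∅ := by
        refine Set.eq_empty_of_forall_notMem fun y hy =>
          hb (compat_of_mem h (y := y) (fun i hi => ?_) ?_)
        · exact hy _ ⟨i, List.mem_cons_of_mem _ hi, rfl⟩
        · exact hy _ ⟨b, List.mem_cons_self, rfl⟩
      rw [this, Set.union_empty]
      exact ih s o hs ho
    have hbs : ∀ i ∈ b :: s, ∀ j ∈ b :: s, c i j := by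
      have hb' := List.all_eq_true.1 hb
      simp only [List.mem_cons]
      rintro i (rfl | hi) j (rfl | hj)
      exacts [hr _, hb' _ hj, hc _ _ ▸ hb' _ hi, hs i hi j hj]
    have hst : (Fam.sing (openStar K (τ '' {i | i ∈ b :: s}))).HT none := by
      obtain ⟨t, ht, e⟩ := h.face _ hbs
      exact e ▸ ht_openStar ht
    have ho1 : IsOpen (openStar K (τ '' {i | i ∈ b :: s})) :=
      isOpen_openStar (((b :: s).finite_toSet).image τ)
    have ho2 : IsOpen (starPart K τ s S) := isOpen_starPart s S
    rw [hb, cond_true] at ho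
    by_cases hS : S.any fun b' => compat c b' s
    swap
    · rw [Bool.eq_false_of_not_eq_true hS, cond_false] at ho
      obtain rfl : none = o := Option.some_injective _ ho
      have : starPart K τ s S = ∅ := by
        refine Set.eq_empty_of_forall_notMem fun y hy => hS ?_
        obtain ⟨h1, i, hi, h2⟩ := hy
        exact List.any_eq_true.2 ⟨i, hi, compat_of_mem h h1 h2⟩
      rw [starPart_cons, this, Set.empty_union]
      exact hst
    rw [hS, cond_true] at ho
    have ih1 := fun o => ih (b :: s) o hbs
    have ih2 := fun o => ih s o hs
    rw [starPart_cons]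
    rw [← starPart_inter] at ih1
    split at ho
    · obtain rfl := Option.some_injective _ ho
      exact Fam.HT.union ho2 ho1 (ih2 _ ‹_›) hst (ih1 _ ‹_›)
    · obtain rfl := Option.some_injective _ ho
      exact Fam.HT.union_of_acyclic ho2 ho1 (ih2 _ ‹_›) hst (ih1 _ ‹_›)
    · cases ho

end Flag

end Sing

namespace Sing
open PSG

/-! ### The tubes of the example -/

lemma reach_of_facts {I : PSG ambEx} (h01 : 0 ∈ I.verts → 1 ∈ I.verts → 0 ∈ I.edges ∨ 1 ∈ I.edges)
    (h12 : 1 ∈ I.verts → 2 ∈ I.verts → 2 ∈ I.edges) (h02 : 0 ∈ I.verts → 2 ∈ I.verts → 1 ∈ I.verts)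
    {v w : Fin 3} (hv : v ∈ I.verts) (hw : w ∈ I.verts) : reachIn I v w := by
  have e01 : 0 ∈ I.verts → 1 ∈ I.verts → adjIn I 0 1 := fun h h' =>
    (h01 h h').elim (fun h => ⟨0, h, rfl⟩) fun h => ⟨1, h, rfl⟩
  have e12 : 1 ∈ I.verts → 2 ∈ I.verts → adjIn I 1 2 := fun h h' => ⟨2, h12 h h', rfl⟩
  have hs : ∀ {v w}, adjIn I v w → adjIn I w v := fun ⟨e, he, h⟩ => ⟨e, he, h.trans Sym2.eq_swap⟩
  have r01 := fun h h' => Relation.ReflTransGen.single (e01 h h')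
  have r10 := fun h h' => Relation.ReflTransGen.single (hs (e01 h h'))
  have r12 := fun h h' => Relation.ReflTransGen.single (e12 h h')
  have r21 := fun h h' => Relation.ReflTransGen.single (hs (e12 h h'))
  fin_cases v <;> fin_cases w
  exacts [.refl, r01 hv hw, (r01 hv (h02 hv hw)).trans (r12 (h02 hv hw) hw), r10 hw hv, .refl,
    r12 hv hw, (r21 (h02 hw hv) hv).trans (r10 hw (h02 hw hv)), r21 hw hv, .refl]

lemma tubeIn_iff (I : PSG ambEx) : TubeIn pgEx I ↔ I.verts.Nonempty ∧
    (0 ∈ I.verts → 1 ∈ I.verts → 0 ∈ I.edges ∨ 1 ∈ I.edges) ∧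
    (1 ∈ I.verts → 2 ∈ I.verts → 2 ∈ I.edges) ∧ (0 ∈ I.verts → 2 ∈ I.verts → 1 ∈ I.verts) ∧
    ((∃ v, v ∉ I.verts) ∨ ∃ e, e ∉ I.edges) := by
  constructor
  · rintro ⟨⟨-, hsi⟩, ⟨hne, hc⟩, hp⟩
    refine ⟨hne, fun h0 h1 => ?_, fun h1 h2 => ?_, fun h0 h2 => ?_, ?_⟩
    · obtain ⟨e, he, h⟩ := hsi 0 (Finset.mem_univ _) (by simp [ambEx, h0, h1])
      fin_cases e
      · exact Or.inl he
      · exact Or.inr he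
      · simp [ambEx] at h
    · obtain ⟨e, he, h⟩ := hsi 2 (Finset.mem_univ _) (by simp [ambEx, h1, h2])
      fin_cases e
      · simp [ambEx] at h
      · simp [ambEx] at h
      · exact he
    · obtain h | ⟨x, ⟨e, he, h⟩, -⟩ := (hc 0 h0 2 h2).cases_head
      · simp at h
      · refine I.incl e he 1 ?_
        fin_cases e
        · simp [ambEx]
        · simp [ambEx]
        · simp [ambEx] at h
    · obtain ⟨v, -, hv, -⟩ | ⟨e, -, -, he⟩ := hp
      · exact Or.inl ⟨v, hv⟩
      · exact Or.inr ⟨e, he⟩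
  · rintro ⟨hne, h01, h12, h02, hp⟩
    refine ⟨⟨⟨Finset.subset_univ _, Finset.subset_univ _⟩, fun e _ h => ?_⟩,
      ⟨hne, fun v hv w hw => reach_of_facts h01 h12 h02 hv hw⟩, ?_⟩
    · fin_cases e
      · simp [ambEx] at h
        exact (h01 h.1 h.2).elim (fun h => ⟨0, h, rfl⟩) fun h => ⟨1, h, rfl⟩
      · simp [ambEx] at h
        exact (h01 h.1 h.2).elim (fun h => ⟨0, h, rfl⟩) fun h => ⟨1, h, rfl⟩
      · simp [ambEx] at h
        exact ⟨2, h12 h.1 h.2, rfl⟩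
    · by_cases hv : ∃ v, v ∉ I.verts
      · obtain ⟨v, hv⟩ := hv
        obtain ⟨w, hw⟩ := hne
        exact Or.inl ⟨v, Finset.mem_univ _, hv, w, hw, reach_of_facts
          (fun _ _ => Or.inl (Finset.mem_univ _)) (fun _ _ => Finset.mem_univ _)
          (fun _ _ => Finset.mem_univ _) (Finset.mem_univ _) (Finset.mem_univ _)⟩
      · obtain ⟨e, he⟩ := hp.resolve_left hv
        push Not at hv
        exact Or.inr ⟨e, Finset.mem_univ _, fun v _ => hv v, he⟩

/-- The nodes of the nine tubes. -/
def tubeVert : Fin 9 → Fin 3 → Bool :=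
  ![![true, false, false], ![false, true, false], ![false, false, true], ![true, true, false],
    ![true, true, false], ![true, true, false], ![false, true, true], ![true, true, true],
    ![true, true, true]]

/-- The edges of the nine tubes. -/
def tubeEdge : Fin 9 → Fin 3 → Bool :=
  ![![false, false, false], ![false, false, false], ![false, false, false], ![true, false, false],
    ![false, true, false], ![true, true, false], ![false, false, true], ![true, false, true],
    ![false, true, true]]

/-- The nine tubes. -/
noncomputable def tube (i : Fin 9) : PSG ambEx where
  verts := Finset.univ.filter fun v => tubeVert i v = true
  edges := Finset.univ.filter fun e => tubeEdge i e = true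
  incl := by
    intro e he v hv
    simp only [Finset.mem_filter_univ] at he ⊢
    revert he hv
    fin_cases i <;> fin_cases e <;> fin_cases v <;> simp [tubeVert, tubeEdge, ambEx]

@[simp] lemma mem_tube_verts {i : Fin 9} {v : Fin 3} : v ∈ (tube i).verts ↔
    tubeVert i v = true := by
  simp [tube]

@[simp] lemma mem_tube_edges {i : Fin 9} {e : Fin 3} : e ∈ (tube i).edges ↔
    tubeEdge i e = true := by
  simp [tube]

lemma tubeIn_tube (i : Fin 9) : TubeIn pgEx (tube i) := by
  rw [tubeIn_iff]
  simp only [Finset.Nonempty, mem_tube_verts, mem_tube_edges, Fin.exists_fin_succ]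
  fin_cases i <;> simp [tubeVert, tubeEdge]

lemma exists_tube_eq {I : PSG ambEx} (h : TubeIn pgEx I) : ∃ i, tube i = I := by
  have key : ∀ i, (∀ v, tubeVert i v = decide (v ∈ I.verts)) →
      (∀ e, tubeEdge i e = decide (e ∈ I.edges)) → tube i = I := by
    intro i hv he
    have hv' : (tube i).verts = I.verts := by
      ext v
      simp [hv]
    have he' : (tube i).edges = I.edges := by
      ext e
      simp [he]
    cases I
    cases h : tube i
    simp_all
  suffices h : ∃ i, (∀ v, tubeVert i v = decide (v ∈ I.verts)) ∧
      ∀ e, tubeEdge i e = decide (e ∈ I.edges) from h.imp fun i hi => key i hi.1 hi.2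
  have hi : ∀ e v, v ∈ ambEx.ends e → e ∈ I.edges → v ∈ I.verts := fun e v hv he => I.incl e he v hv
  rw [tubeIn_iff] at h
  have h0 := hi 0
  have h1 := hi 1
  have h2 := hi 2
  clear hi key
  simp only [Finset.Nonempty, Fin.exists_fin_succ, Fin.forall_fin_succ] at *
  simp [ambEx] at h h0 h1 h2 ⊢
  by_cases a0 : 0 ∈ I.verts <;> by_cases a1 : 1 ∈ I.verts <;> by_cases a2 : 2 ∈ I.verts <;>
  by_cases e0 : 0 ∈ I.edges <;> by_cases e1 : 1 ∈ I.edges <;> by_cases e2 : 2 ∈ I.edges <;>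
  simp [a0, a1, a2, e0, e1, e2, tubeVert, tubeEdge] at h h0 h1 h2 ⊢

end Sing

namespace Sing
open PSG

/-- The conjunction of three values. -/
def all3 (p : Fin 3 → Bool) : Bool := p 0 && (p 1 && p 2)

lemma all3_iff {p : Fin 3 → Bool} : all3 p = true ↔ ∀ x, p x = true := by
  simp [all3, Fin.forall_fin_succ]

/-- Inclusion of tubes. -/
def tubeLe (i j : Fin 9) : Bool :=
  all3 fun x => (!tubeVert i x || tubeVert j x) && (!tubeEdge i x || tubeEdge j x)

lemma tubeLe_iff {i j : Fin 9} : tubeLe i j = true ↔ Le (tube i) (tube j) := by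
  simp only [tubeLe, all3_iff, Le, Finset.subset_iff, mem_tube_verts, mem_tube_edges,
    Bool.and_eq_true, Bool.or_eq_true, Bool.not_eq_true', ← Bool.not_eq_true, ← imp_iff_not_or,
    forall_and]

/-- The endpoints of the edges. -/
def exEnds : Fin 3 → Fin 3 × Fin 3 := ![(0, 1), (0, 1), (1, 2)]

/-- Separation of tubes. -/
def tubeSep (i j : Fin 9) : Bool :=
  all3 fun x => !(tubeVert i x && tubeVert j x) &&
    !((tubeVert i (exEnds x).1 || tubeVert i (exEnds x).2) &&
      (tubeVert j (exEnds x).1 || tubeVert j (exEnds x).2))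

lemma exists_mem_ends {P : Fin 3 → Prop} (e : Fin 3) :
    (∃ v ∈ ambEx.ends e, P v) ↔ P (exEnds e).1 ∨ P (exEnds e).2 := by
  fin_cases e <;> simp [ambEx, exEnds]

lemma tubeSep_iff {i j : Fin 9} : tubeSep i j = true ↔ SeparatedIn pgEx (tube i) (tube j) := by
  simp only [tubeSep, all3_iff, SeparatedIn, Finset.disjoint_left, mem_tube_verts,
    exists_mem_ends, Bool.and_eq_true, Bool.or_eq_true, Bool.not_eq_true', ← Bool.not_eq_true,
    forall_and, not_and]
  simp [pgEx]

/-- Compatibility of tubes. -/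
def tubeCompat (i j : Fin 9) : Bool := tubeLe i j || (tubeLe j i || tubeSep i j)

lemma tubeCompat_iff {i j : Fin 9} : tubeCompat i j = true ↔ Compatible pgEx (tube i) (tube j) := by
  simp only [tubeCompat, Bool.or_eq_true, tubeLe_iff, tubeSep_iff, Compatible]
  refine ⟨Or.inr, fun h => h.elim (fun h => Or.inl ?_) id⟩
  rw [h]
  exact ⟨subset_rfl, subset_rfl⟩

lemma tubeCompat_self (i : Fin 9) : tubeCompat i i = true := tubeCompat_iff.2 (Or.inl rfl)

lemma tubeCompat_comm (i j : Fin 9) : tubeCompat i j = tubeCompat j i := by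
  have h : tubeSep i j = tubeSep j i := by
    simp only [tubeSep, Bool.and_comm]
  rw [tubeCompat, tubeCompat, h, Bool.or_left_comm]

lemma isFlag_tube : IsFlag (tubingComplex pgEx) tubeCompat tube where
  compatible s hs i j hi hj := tubeCompat_iff.2 (hs.2 _ hi _ hj)
  face σ hσ := by
    refine ⟨(σ.map tube).toFinset, ⟨fun I hI => ?_, fun I hI J hJ => ?_⟩, ?_⟩
    · obtain ⟨i, -, rfl⟩ := List.mem_map.1 (List.mem_toFinset.1 hI)
      exact tubeIn_tube i
    · obtain ⟨i, hi, rfl⟩ := List.mem_map.1 (List.mem_toFinset.1 hI)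
      obtain ⟨j, hj, rfl⟩ := List.mem_map.1 (List.mem_toFinset.1 hJ)
      exact tubeCompat_iff.1 (hσ i hi j hj)
    · ext I
      simp

/-- The index set of the characteristic function. -/
abbrev Idx : Type := RG pgEx (fun _ => 2) (fun _ => 1)

lemma mem_cls {e : Fin 3} {p : Sym2 (Fin 3)} : e ∈ pgEx.cls p ↔ ambEx.ends e = p :=
  Finset.mem_filter.trans (and_iff_right (Finset.mem_univ _))

lemma multipleIn_zero : MultipleIn pgEx 0 :=
  ⟨Finset.mem_univ _, Finset.one_lt_card.2 ⟨0, mem_cls.2 rfl, 1, mem_cls.2 rfl, by simp⟩⟩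

lemma not_multipleIn_two : ¬ MultipleIn pgEx 2 := by
  rintro ⟨-, h⟩
  obtain ⟨e, he, e', he', hne⟩ := Finset.one_lt_card.1 h
  have key : ∀ e, e ∈ pgEx.cls (ambEx.ends 2) → e = 2 := by
    intro e he
    rw [mem_cls] at he
    fin_cases e <;> simp [ambEx] at he ⊢
  exact hne ((key e he).trans (key e' he').symm)

/-- The three elements of the index set. -/
def idx : Fin 3 → Idx :=
  ![Sum.inl ⟨0, Finset.mem_univ _, by simp⟩, Sum.inl ⟨1, Finset.mem_univ _, by simp⟩,
    Sum.inr ⟨0, multipleIn_zero, by simp⟩]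

lemma idx_bijective : Function.Bijective idx := by
  constructor
  · intro i j h
    fin_cases i <;> fin_cases j <;>
    first
    | rfl
    | exact absurd (congrArg Subtype.val (Sum.inl.inj h)) (by simp)
    | cases h
  · rintro (⟨v, hv, h⟩ | ⟨e, he, h⟩)
    · fin_cases v
      exacts [⟨0, rfl⟩, ⟨1, rfl⟩, absurd rfl h]
    · fin_cases e
      exacts [⟨2, rfl⟩, absurd rfl h, absurd he not_multipleIn_two]

noncomputable instance : Fintype Idx := Fintype.ofBijective idx idx_bijective

/-- The coordinates of the characteristic vector of a tube. -/
def tubeLam (i : Fin 9) : Fin 3 → Bool :=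
  ![tubeVert i 0 ^^ tubeVert i 2, tubeVert i 1 ^^ tubeVert i 2, tubeEdge i 0 ^^ tubeEdge i 1]

lemma lamG_tube (i : Fin 9) (k : Fin 3) :
    lamG pgEx (fun _ => 2) (fun _ => 1) (tube i) (idx k) = if tubeLam i k = true then 1 else 0 := by
  have h : ∀ (p q : Prop) [Decidable p] [Decidable q] (a b : Bool), (p ↔ a = true) →
      (q ↔ b = true) → ((if p then 1 else 0) + (if q then 1 else 0) : ZMod 2) =
        if (a ^^ b) = true then 1 else 0 := by
    rintro p q _ _ (_ | _) (_ | _) hp hq <;> simp [hp, hq]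
    rfl
  fin_cases k
  · exact h (0 ∈ (tube i).verts) (2 ∈ (tube i).verts) _ _ mem_tube_verts mem_tube_verts
  · exact h (1 ∈ (tube i).verts) (2 ∈ (tube i).verts) _ _ mem_tube_verts mem_tube_verts
  · exact h (0 ∈ (tube i).edges) (1 ∈ (tube i).edges) _ _ mem_tube_edges mem_tube_edges

/-- The tubes whose characteristic vector pairs to one with a given covector. -/
def oddTubes (w : Fin 3 → Bool) : List (Fin 9) :=
  [5, 4, 1, 3, 8, 0, 2, 7, 6].filter fun i =>
    (w 0 && tubeLam i 0) ^^ ((w 1 && tubeLam i 1) ^^ (w 2 && tubeLam i 2))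

/-- The coordinates of a covector. -/
noncomputable def coords (ω : Idx → ZMod 2) (k : Fin 3) : Bool := decide (ω (idx k) = 1)

lemma mem_oddTubes (ω : Idx → ZMod 2) (i : Fin 9) :
    i ∈ oddTubes (coords ω) ↔ ω ⬝ᵥ lamG pgEx (fun _ => 2) (fun _ => 1) (tube i) = 1 := by
  have hi : i ∈ ([5, 4, 1, 3, 8, 0, 2, 7, 6] : List (Fin 9)) := by
    fin_cases i <;> simp
  have e : ω ⬝ᵥ lamG pgEx (fun _ => 2) (fun _ => 1) (tube i) =
      ∑ k, ω (idx k) * if tubeLam i k = true then 1 else 0 := by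
    rw [dotProduct, ← Function.Bijective.sum_comp idx_bijective]
    simp only [lamG_tube]
  rw [oddTubes, List.mem_filter, e, Fin.sum_univ_three]
  simp only [hi, true_and, coords]
  generalize tubeLam i 0 = a
  generalize tubeLam i 1 = b
  generalize tubeLam i 2 = c
  have h2 : (1 + 1 : ZMod 2) = 0 := rfl
  rcases zmod_two_cases (ω (idx 0)) with h | h <;>
  rcases zmod_two_cases (ω (idx 1)) with h' | h' <;>
  rcases zmod_two_cases (ω (idx 2)) with h'' | h'' <;> rw [h, h', h''] <;>
  cases a <;> cases b <;> cases c <;> simp [h2]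

lemma oddSet_eq (ω : Idx → ZMod 2) :
    oddSet (tubingComplex pgEx) (lamG pgEx (fun _ => 2) (fun _ => 1)) ω =
      starPart (tubingComplex pgEx) tube [] (oddTubes (coords ω)) := by
  ext y
  constructor
  · rintro ⟨I, hI, h⟩
    obtain ⟨i, rfl⟩ := exists_tube_eq (y.2.2.2.1 I (by simpa using hI))
    exact ⟨by simp, i, (mem_oddTubes ω i).2 h, hI⟩
  · rintro ⟨-, i, hi, h⟩
    exact ⟨tube i, h, (mem_oddTubes ω i).1 hi⟩

/-- The homology types of the sets of points on odd facets. -/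
def exType : Bool → Bool → Bool → Option ℕ
  | false, false, false => some 0
  | true, false, _ => none
  | false, false, true => some 1
  | _, true, false => some 1
  | _, true, true => some 2

lemma flagType_oddTubes (w : Fin 3 → Bool) :
    flagType tubeCompat [] (oddTubes w) = some (exType (w 0) (w 1) (w 2)) := by
  obtain ⟨a, b, c, rfl⟩ : ∃ a b c, w = ![a, b, c] :=
    ⟨w 0, w 1, w 2, by ext k; fin_cases k <;> rfl⟩
  cases a <;> cases b <;> cases c <;> rfl

lemma card_exType (n : ℕ) :
    Fintype.card {ω : Idx → ZMod 2 //
      exType (coords ω 0) (coords ω 1) (coords ω 2) = some n} =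
        if n = 0 then 1 else if n = 1 then 3 else if n = 2 then 2 else 0 := by
  have hb : Function.Bijective coords := by
    constructor
    · intro ω ω' h
      funext r
      obtain ⟨k, rfl⟩ := idx_bijective.2 r
      have := congrFun h k
      rcases zmod_two_cases (ω (idx k)) with h1 | h1 <;>
      rcases zmod_two_cases (ω' (idx k)) with h2 | h2 <;> simp [coords, h1, h2] at this ⊢
    · intro w
      refine ⟨fun r => if w ((Equiv.ofBijective idx idx_bijective).symm r) = true then 1 else 0, ?_⟩
      funext k
      have : (Equiv.ofBijective idx idx_bijective).symm (idx k) = k :=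
        (Equiv.ofBijective idx idx_bijective).symm_apply_apply k
      simp [coords, this]
  let e : (Idx → ZMod 2) ≃ Bool × Bool × Bool := (Equiv.ofBijective coords hb).trans
    ⟨fun w => (w 0, w 1, w 2), fun p => ![p.1, p.2.1, p.2.2],
      fun w => by ext k; fin_cases k <;> rfl, fun p => rfl⟩
  refine (Fintype.card_congr (e.subtypeEquiv (q := fun p => exType p.1 p.2.1 p.2.2 = some n)
    fun _ => Iff.rfl)).trans ?_
  rw [Fintype.card_subtype, Finset.card_filter, Fintype.sum_prod_type]
  simp only [Fintype.sum_prod_type, Fintype.sum_bool, exType, Option.some_inj, reduceCtorEq]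
  rcases n with _ | _ | _ | n <;> simp

end Sing

open PSG in
/-- For the pseudograph `G` with three nodes, one bundle of two edges
and one simple edge, the Poincaré polynomial of the associated real toric manifold is
`Poin_{M_G}(t) = 1 + 3t + 2t²`. -/
theorem stmt17 :
    ∀ i : ℕ, betti (MG pgEx (fun _ => 2) (fun _ => 1)) i =
      if i = 0 then 1 else if i = 1 then 3 else if i = 2 then 2 else 0 := by
  intro n
  have hK : (Sing.Fam.sing (Set.univ : Set (tubingComplex pgEx).coneRealization)).HT none := by
    have h := Sing.ht_openStar (K := tubingComplex pgEx) (T := ∅) (by simp [tubingComplex])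
    rwa [show Sing.openStar (tubingComplex pgEx) ↑(∅ : Finset (PSG ambEx)) = Set.univ by
      simp [Sing.openStar]] at h
  obtain ⟨ζ, hζ, hi, hs⟩ := Sing.exists_basis (lam := lamG pgEx (fun _ => 2) (fun _ => 1)) hK
    (fun ω => Sing.exType (Sing.coords ω 0) (Sing.coords ω 1) (Sing.coords ω 2)) (fun ω => by
      rw [Sing.oddSet_eq]
      exact Sing.ht_starPart Sing.isFlag_tube Sing.tubeCompat_self Sing.tubeCompat_comm _ [] _
        (by simp) (Sing.flagType_oddTubes _)) n
  exact (Sing.betti_eq_card ζ hζ hi hs).trans (Sing.card_exType n)
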